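/- There exist constants c1, c2 > 0 and a family of DAGs {M_n} (for all n ≥ 1) such that each M_n has n designated inputs, n designated outputs, at most c1·n nodes, maximum indegree at most c2, and is maximally ST-robust. -/

import Mathlib

/-! ## Basic digraph notions -/

/-- A directed path in a digraph `Adj`: a nonempty list of vertices, each
consecutive pair joined by a directed edge.  Its length (number of edges)
is `p.length - 1`, so a path "of length d" is a list with `p.length = d + 1`. -/
def PathIn {V : Type*} (Adj : V → V → Prop) (p : List V) : Prop :=
  p ≠ [] ∧ p.Chain' Adj

/-- A digraph is acyclic (is a DAG) if it has no directed cycle. -/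
def Acyclic {V : Type*} (Adj : V → V → Prop) : Prop :=
  ∀ v, ¬ Relation.TransGen Adj v v

/-- In-degree of a vertex. -/
noncomputable def indeg {V : Type*} (Adj : V → V → Prop) (v : V) : ℕ :=
  Nat.card {u // Adj u v}

/-- Out-degree of a vertex. -/
noncomputable def outdeg {V : Type*} (Adj : V → V → Prop) (v : V) : ℕ :=
  Nat.card {w // Adj v w}

/-- `δ(v) = max(indeg(v), outdeg(v))`. -/
noncomputable def delta {V : Type*} (Adj : V → V → Prop) (v : V) : ℕ :=
  max (indeg Adj v) (outdeg Adj v)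

/-- The number of edges of a digraph. -/
noncomputable def numEdges {V : Type*} (Adj : V → V → Prop) : ℕ :=
  Nat.card {e : V × V // Adj e.1 e.2}

/-- `(e,d)`-depth-robustness: for every set `S` of at most `e` vertices,
the graph minus `S` contains a directed path of length `d` (i.e. `d` edges). -/
def DepthRobust {V : Type*} (Adj : V → V → Prop) (e d : ℕ) : Prop :=
  ∀ S : Finset V, S.card ≤ e →
    ∃ p : List V, PathIn Adj p ∧ (∀ v ∈ p, v ∉ S) ∧ p.length = d + 1

/-- `(e,d)`-edge-depth-robustness: for every set `F` of at most `e` edges,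
the graph minus `F` contains a directed path of length `d`. -/
def EdgeDepthRobust {V : Type*} (Adj : V → V → Prop) (e d : ℕ) : Prop :=
  ∀ F : Finset (V × V), (∀ f ∈ F, Adj f.1 f.2) → F.card ≤ e →
    ∃ p : List V, PathIn (fun u w => Adj u w ∧ (u, w) ∉ F) p ∧ p.length = d + 1

/-- `u` is joined to `v` by a directed path all of whose vertices avoid `S`. -/
def ConnAvoiding {V : Type*} (Adj : V → V → Prop) (S : Finset V) (u v : V) : Prop :=
  ∃ p : List V, PathIn Adj p ∧ (∀ x ∈ p, x ∉ S) ∧ p.head? = some u ∧ p.getLast? = some v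

/-- `u` is joined to `v` by a directed path of length at least `d` avoiding `S`. -/
def ConnAvoidingLen {V : Type*} (Adj : V → V → Prop) (S : Finset V) (d : ℕ) (u v : V) : Prop :=
  ∃ p : List V, PathIn Adj p ∧ (∀ x ∈ p, x ∉ S) ∧ p.head? = some u ∧
    p.getLast? = some v ∧ d + 1 ≤ p.length

/-! ## Digraphs with designated inputs and outputs -/

/-- A finite digraph with `n` designated (distinct) inputs and `n` designated
(distinct) outputs. -/
structure IOGraph (n : ℕ) where
  V : Type
  [fin : Fintype V]
  [dec : DecidableEq V]
  Adj : V → V → Prop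
  inp : Fin n ↪ V
  out : Fin n ↪ V

attribute [instance] IOGraph.fin IOGraph.dec

/-- `(k1,k2)`-ST-robustness: after deleting any set `D` of at most `k1` vertices
there remain at least `k2` inputs and `k2` outputs such that every one of these
inputs is connected to every one of these outputs in `G - D`. -/
def STRobust {n : ℕ} (G : IOGraph n) (k1 k2 : ℕ) : Prop :=
  ∀ D : Finset G.V, D.card ≤ k1 →
    ∃ A B : Finset (Fin n), k2 ≤ A.card ∧ k2 ≤ B.card ∧
      ∀ a ∈ A, ∀ b ∈ B, ConnAvoiding G.Adj D (G.inp a) (G.out b)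

/-- `(k1,k2,d)`-ST-robustness: as `STRobust`, with all the connecting paths of
length at least `d`. -/
def STRobustD {n : ℕ} (G : IOGraph n) (k1 k2 d : ℕ) : Prop :=
  ∀ D : Finset G.V, D.card ≤ k1 →
    ∃ A B : Finset (Fin n), k2 ≤ A.card ∧ k2 ≤ B.card ∧
      ∀ a ∈ A, ∀ b ∈ B, ConnAvoidingLen G.Adj D d (G.inp a) (G.out b)

/-- Maximally ST-robust: `(k, n-k)`-ST-robust for all `0 ≤ k ≤ n`. -/
def MaxSTRobust {n : ℕ} (G : IOGraph n) : Prop := ∀ k ≤ n, STRobust G k (n - k)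

/-- Maximally ST-robust with depth `d`: `(k, n-k, d)`-ST-robust for all `0 ≤ k ≤ n`. -/
def MaxSTRobustD {n : ℕ} (G : IOGraph n) (d : ℕ) : Prop := ∀ k ≤ n, STRobustD G k (n - k) d

/-- An `n`-superconcentrator: for every `1 ≤ r ≤ n` and every `r` inputs and `r`
outputs there are `r` vertex-disjoint directed paths connecting the chosen inputs
to the chosen outputs. -/
def Superconcentrator {n : ℕ} (G : IOGraph n) : Prop :=
  ∀ r, 1 ≤ r → r ≤ n → ∀ X Y : Finset (Fin n), X.card = r → Y.card = r →
    ∃ P : Fin r → List G.V,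
      (∀ i, PathIn G.Adj (P i) ∧ (∃ x ∈ X, (P i).head? = some (G.inp x)) ∧
        ∃ y ∈ Y, (P i).getLast? = some (G.out y)) ∧
      ∀ i j, i ≠ j → ∀ v ∈ P i, v ∉ P j

/-- An `n`-connector: an `n`-superconcentrator such that moreover, for every
`1 ≤ r ≤ n`, every sequence of `r` distinct inputs and every sequence of `r`
distinct outputs, there are `r` vertex-disjoint directed paths where the `i`-th
path goes from the `i`-th chosen input to the `i`-th chosen output. -/
def Connector {n : ℕ} (G : IOGraph n) : Prop :=
  Superconcentrator G ∧
  ∀ r, 1 ≤ r → r ≤ n → ∀ x y : Fin r ↪ Fin n,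
    ∃ P : Fin r → List G.V,
      (∀ i, PathIn G.Adj (P i) ∧ (P i).head? = some (G.inp (x i)) ∧
        (P i).getLast? = some (G.out (y i))) ∧
      ∀ i j, i ≠ j → ∀ v ∈ P i, v ∉ P j

/-- A bundled finite digraph. -/
structure Dig where
  V : Type
  [fin : Fintype V]
  [dec : DecidableEq V]
  Adj : V → V → Prop

attribute [instance] Dig.fin Dig.dec

/-- `(s,t,ε)`-hardness of a graph together with a challenge set `VC`: for every
set `S` of at most `s` vertices, at least a `(1-ε)` fraction of the nodes of `VC`
have depth at least `t` in `G - S` (i.e. are the endpoint of a directed path of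
length `≥ t` in `G - S`). -/
def Hard {T : Type*} (Adj : T → T → Prop) (VC : Finset T) (s t : ℕ) (ε : ℝ) : Prop :=
  ∀ S : Finset T, S.card ≤ s →
    (1 - ε) * (VC.card : ℝ) ≤
      (Set.ncard {v | v ∈ VC ∧ ∃ p : List T, PathIn Adj p ∧ (∀ x ∈ p, x ∉ S) ∧
        p.getLast? = some v ∧ t + 1 ≤ p.length} : ℝ)

section STR
open Relation

/-- alive reachability in a graph given by an edge type -/
def RR {V E : Type} (src tgt : E → V) (D : Finset V) (u v : V) : Prop :=
  u ∉ D ∧ ReflTransGen (fun x y => (∃ e, src e = x ∧ tgt e = y) ∧ y ∉ D) u v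

/-- linear size robust graph, edges counted -/
def GdP (c n : ℕ) : Prop :=
  ∃ (V E : Type) (_ : Fintype V) (_ : Fintype E) (src tgt : E → V) (rk : V → ℕ)
    (inp out : Fin n → V), Function.Injective inp ∧ Function.Injective out ∧
    (∀ e, rk (src e) < rk (tgt e)) ∧ Fintype.card V ≤ c * n ∧ Fintype.card E ≤ c * n ∧
    ∀ D : Finset V, ∃ A B : Finset (Fin n), n ≤ A.card + D.card ∧ n ≤ B.card + D.card ∧
      ∀ a ∈ A, ∀ b ∈ B, RR src tgt D (inp a) (out b)

/-- the indegree reduction: adjacency -/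
def chAdj {V : Type} {k : ℕ} (src tgt : Fin k → V) : Fin k ⊕ V → Fin k ⊕ V → Prop
  | Sum.inl e, Sum.inl e' => tgt e = tgt e' ∧ e < e' ∧ ∀ e'', tgt e'' = tgt e → ¬ (e < e'' ∧ e'' < e')
  | Sum.inl e, Sum.inr v => tgt e = v ∧ ∀ e'', tgt e'' = v → e'' ≤ e
  | Sum.inr u, Sum.inl e => src e = u
  | Sum.inr _, Sum.inr _ => False

theorem chAdj_indeg {V : Type} [Finite V] {k : ℕ} (src tgt : Fin k → V) (v : Fin k ⊕ V) :
    indeg (chAdj src tgt) v ≤ 2 := by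
  classical
  unfold indeg
  rcases v with e | v
  · -- map to Bool by isLeft
    have hinj : Function.Injective (fun u : {u // chAdj src tgt u (Sum.inl e)} => u.1.isLeft) := by
      rintro ⟨a | a, ha⟩ ⟨b | b, hb⟩ h
      · simp only [chAdj] at ha hb
        obtain ⟨h1, h2, h3⟩ := ha
        obtain ⟨g1, g2, g3⟩ := hb
        rcases lt_trichotomy a b with hab | hab | hab
        · exact absurd ⟨hab, g2⟩ (h3 b (by rw [g1, h1]))
        · subst hab; rfl
        · exact absurd ⟨hab, h2⟩ (g3 a (by rw [g1, h1]))
      · simp at h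
      · simp at h
      · simp only [chAdj] at ha hb
        subst ha; subst hb; rfl
    have := Nat.card_le_card_of_injective _ hinj
    simpa using this
  · have hinj : Function.Injective (fun u : {u // chAdj src tgt u (Sum.inr v)} => u.1.isLeft) := by
      rintro ⟨a | a, ha⟩ ⟨b | b, hb⟩ h
      · simp only [chAdj] at ha hb
        have := le_antisymm (hb.2 a ha.1) (ha.2 b hb.1)
        subst this; rfl
      · simp at h
      · simp at h
      · simp only [chAdj] at ha
    have := Nat.card_le_card_of_injective _ hinj
    simpa using this

theorem chAdj_rank {V : Type} {k : ℕ} (src tgt : Fin k → V) (rk : V → ℕ)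
    (h : ∀ e, rk (src e) < rk (tgt e)) (u v : Fin k ⊕ V) (huv : chAdj src tgt u v) :
    (Sum.elim (fun e => rk (tgt e) * (k + 1) + e.1) (fun v => rk v * (k + 1) + k) u : ℕ) <
    Sum.elim (fun e => rk (tgt e) * (k + 1) + e.1) (fun v => rk v * (k + 1) + k) v := by
  rcases u with e | u <;> rcases v with e' | v <;> simp only [chAdj] at huv
  · simp only [Sum.elim_inl]
    rw [huv.1]
    have := huv.2.1
    have : e.1 < e'.1 := this
    omega
  · simp only [Sum.elim_inl, Sum.elim_inr]
    rw [huv.1]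
    have := e.2
    omega
  · simp only [Sum.elim_inl, Sum.elim_inr]
    subst huv
    have := h e'
    nlinarith

theorem acyclic_of_rank {V : Type} (Adj : V → V → Prop) (rk : V → ℕ)
    (h : ∀ u v, Adj u v → rk u < rk v) : Acyclic Adj := by
  intro v hv
  have : ∀ w, Relation.TransGen Adj v w → rk v < rk w := by
    intro w hw
    induction hw with
    | single h1 => exact h _ _ h1
    | tail _ h1 ih => exact ih.trans (h _ _ h1)
  exact lt_irrefl _ (this v hv)

theorem conn_of_reach {V : Type} (Adj : V → V → Prop) (D : Finset V) (u v : V) (hu : u ∉ D)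
    (h : ReflTransGen (fun x y => Adj x y ∧ y ∉ D) u v) : ConnAvoiding Adj D u v := by
  induction h using ReflTransGen.head_induction_on with
  | refl => exact ⟨[v], ⟨by simp, List.isChain_singleton _⟩, by simpa using hu, by simp, by simp⟩
  | head h1 _ ih =>
    obtain ⟨p, ⟨hp1, hp2⟩, hp3, hp4, hp5⟩ := ih h1.2
    rename_i a c _
    obtain ⟨x, l, rfl⟩ := List.exists_cons_of_ne_nil hp1
    simp only [List.head?_cons, Option.some.injEq] at hp4
    subst hp4
    refine ⟨a :: x :: l, ⟨by simp, ?_⟩, ?_, by simp, ?_⟩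
    · exact List.isChain_cons_cons.2 ⟨h1.1, hp2⟩
    · intro y hy
      rcases List.mem_cons.1 hy with rfl | hy
      · exact hu
      · exact hp3 y hy
    · rw [← hp5]; simp

theorem chAdj_lift_step {V : Type} [DecidableEq V] {k : ℕ} (src tgt : Fin k → V)
    (D' : Finset (Fin k ⊕ V)) (w : V) (hw : ∀ x ∈ D', Sum.elim tgt id x ≠ w) (e : Fin k)
    (he : tgt e = w) :
    ReflTransGen (fun x y => chAdj src tgt x y ∧ y ∉ D') (Sum.inl e) (Sum.inr w) := by
  have hr : Sum.inr w ∉ D' := fun h => hw _ h rfl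
  have hl : ∀ e, tgt e = w → Sum.inl e ∉ D' := fun e he h => hw _ h he
  induction hk : (k - e.1) using Nat.strong_induction_on generalizing e with
  | _ j ih =>
    by_cases hlast : ∀ e'', tgt e'' = w → e'' ≤ e
    · exact ReflTransGen.single ⟨⟨he, hlast⟩, hr⟩
    · push Not at hlast
      obtain ⟨e1, h1, h2⟩ := hlast
      let s := Finset.univ.filter (fun e'' : Fin k => tgt e'' = w ∧ e < e'')
      have hs : s.Nonempty := ⟨e1, by simp [s, h1, h2]⟩
      have hm := Finset.min'_mem s hs
      set e2 := s.min' hs with he2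
      simp only [s, Finset.mem_filter, Finset.mem_univ, true_and] at hm
      have hstep : chAdj src tgt (Sum.inl e) (Sum.inl e2) := by
        refine ⟨by rw [he, hm.1], hm.2, ?_⟩
        rintro e'' h3 ⟨h4, h5⟩
        have : e2 ≤ e'' := Finset.min'_le s e'' (by simp [s, h4, h3, he])
        exact absurd h5 (not_lt.2 this)
      refine ReflTransGen.head ⟨hstep, hl _ hm.1⟩ (ih (k - e2.1) ?_ e2 hm.1 rfl)
      have : e.1 < e2.1 := hm.2
      have := e2.2
      omega

theorem final_of_GdP (h : ∃ c : ℕ, ∀ n, 1 ≤ n → GdP c n) :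
    ∃ c1 c2 : ℕ, 0 < c1 ∧ 0 < c2 ∧
      ∃ M : (n : ℕ) → IOGraph n, ∀ n, 1 ≤ n →
        Acyclic (M n).Adj ∧
        Nat.card (M n).V ≤ c1 * n ∧
        (∀ v : (M n).V, indeg (M n).Adj v ≤ c2) ∧
        MaxSTRobust (M n) := by
  classical
  obtain ⟨c, hc⟩ := h
  have key : ∀ n, 1 ≤ n → ∃ M : IOGraph n, Acyclic M.Adj ∧
        Nat.card M.V ≤ (2 * c + 1) * n ∧
        (∀ v : M.V, indeg M.Adj v ≤ 2) ∧
        MaxSTRobust M := by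
    intro n hn
    obtain ⟨V, E, _, _, src', tgt', rk, inp, out, hi, ho, hrk, hV, hE, hrob⟩ := hc n hn
    let eq := (Fintype.equivFin E)
    let k := Fintype.card E
    let src : Fin k → V := fun e => src' (eq.symm e)
    let tgt : Fin k → V := fun e => tgt' (eq.symm e)
    refine ⟨⟨Fin k ⊕ V, chAdj src tgt, ⟨fun i => Sum.inr (inp i), ?_⟩,
      ⟨fun i => Sum.inr (out i), ?_⟩⟩, ?_, ?_, ?_, ?_⟩
    · intro a b h; exact hi (Sum.inr_injective h)
    · intro a b h; exact ho (Sum.inr_injective h)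
    · exact acyclic_of_rank _ _ (chAdj_rank src tgt rk (fun e => hrk _))
    · simp only [Nat.card_eq_fintype_card, Fintype.card_sum, Fintype.card_fin]
      have : (2 * c + 1) * n = c * n + c * n + n := by ring
      show Fintype.card E + _ ≤ _
      omega
    · intro v; exact chAdj_indeg src tgt v
    · intro kk hk D' hD'
      obtain ⟨A, B, hA, hB, hAB⟩ := hrob (D'.image (Sum.elim tgt id))
      have hcard : (D'.image (Sum.elim tgt id)).card ≤ kk := Finset.card_image_le.trans hD'
      refine ⟨A, B, by omega, by omega, ?_⟩
      intro a ha b hb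
      obtain ⟨h1, h2⟩ := hAB a ha b hb
      apply conn_of_reach
      · intro h
        exact h1 (Finset.mem_image.2 ⟨_, h, rfl⟩)
      · have : ∀ x y, ReflTransGen (fun x y => (∃ e, src' e = x ∧ tgt' e = y) ∧
            y ∉ D'.image (Sum.elim tgt id)) x y →
            ReflTransGen (fun x y => chAdj src tgt x y ∧ y ∉ D') (Sum.inr x) (Sum.inr y) := by
          intro x y hxy
          induction hxy with
          | refl => exact ReflTransGen.refl
          | tail _ hs ih =>
            rename_i y z _
            obtain ⟨⟨e, he1, he2⟩, hz⟩ := hs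
            have hw : ∀ x ∈ D', Sum.elim tgt id x ≠ z :=
              fun x hx hxz => hz (Finset.mem_image.2 ⟨x, hx, hxz⟩)
            have ht : tgt (eq e) = z := by simp [tgt, he2]
            have h3 := chAdj_lift_step src tgt D' z hw (eq e) ht
            refine ih.trans (ReflTransGen.head ⟨?_, ?_⟩ h3)
            · show src (eq e) = y
              simp [src, he1]
            · intro h; exact hw _ h ht
        exact this _ _ h2
  have key2 : ∀ n, ∃ M : IOGraph n, 1 ≤ n → (Acyclic M.Adj ∧
        Nat.card M.V ≤ (2 * c + 1) * n ∧
        (∀ v : M.V, indeg M.Adj v ≤ 2) ∧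
        MaxSTRobust M) := by
    intro n
    by_cases hn : 1 ≤ n
    · obtain ⟨M, hM⟩ := key n hn
      exact ⟨M, fun _ => hM⟩
    · exact ⟨⟨Fin n, fun _ _ => False, Function.Embedding.refl _, Function.Embedding.refl _⟩,
        fun h => absurd h hn⟩
  choose M hM using key2
  exact ⟨2 * c + 1, 2, by omega, by omega, M, hM⟩


theorem card_constrained {α β : Type} [Fintype α] [Fintype β] [DecidableEq α] [DecidableEq β]
    (d : ℕ) (X : Finset α) (Y : Finset β) (F : Finset (β → Fin d → α))
    (hF : ∀ f, f ∈ F ↔ ∀ y ∈ Y, ∀ j, f y j ∈ X) :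
    F.card =
      X.card ^ (d * Y.card) * Fintype.card α ^ (d * (Fintype.card β - Y.card)) := by
  have : F =
      Fintype.piFinset (fun y => Fintype.piFinset (fun _ : Fin d => if y ∈ Y then X else Finset.univ)) := by
    ext f
    simp only [hF, Fintype.mem_piFinset]
    constructor
    · intro h y j
      by_cases hy : y ∈ Y
      · simp [hy, h y hy j]
      · simp [hy]
    · intro h y hy j
      have := h y j
      simpa [hy] using this
  rw [this, Fintype.card_piFinset]
  simp only [Fintype.card_piFinset_const]
  have h1 : ∀ y : β, (if y ∈ Y then X else Finset.univ).card ^ d =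
      if y ∈ Y then X.card ^ d else Fintype.card α ^ d := by
    intro y; split_ifs <;> simp
  simp only [h1]
  rw [Finset.prod_ite]
  simp only [Finset.prod_const]
  have h2 : (Finset.univ.filter (fun y => y ∈ Y)) = Y := by ext; simp
  have h3 : (Finset.univ.filter (fun y => y ∉ Y)).card = Fintype.card β - Y.card := by
    rw [← Finset.card_compl]; congr 1; ext; simp
  rw [h2, h3, ← pow_mul, ← pow_mul]

theorem E1 (q : ℕ) (hq : 1 ≤ q) : ∃ d : ℕ, ∀ (α β : Type) [Fintype α] [Fintype β],
    Fintype.card α ≤ Fintype.card β → 0 < Fintype.card α →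
    ∃ f : β → Fin d → α, ∀ (X : Finset α) (Y : Finset β), Fintype.card α ≤ q * X.card →
      Fintype.card β ≤ q * Y.card → ∃ y ∈ Y, ∃ j, f y j ∈ X := by
  classical
  refine ⟨q * (2 * q), ?_⟩
  intro α β _ _ hab ha
  by_contra hcon
  push Not at hcon
  set a := Fintype.card α with hadef
  set b := Fintype.card β with hbdef
  set d := q * (2 * q) with hd
  let bad : Finset α × Finset β → Finset (β → Fin d → α) := fun p =>
    Finset.univ.filter (fun f : β → Fin d → α => ∀ y ∈ p.2, ∀ j, f y j ∈ p.1ᶜ)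
  let I : Finset (Finset α × Finset β) := Finset.univ.filter (fun p => a ≤ q * p.1.card ∧ b ≤ q * p.2.card)
  have hcov : (Finset.univ : Finset (β → Fin d → α)) ⊆ I.biUnion bad := by
    intro f _
    obtain ⟨X, Y, hX, hY, h⟩ := hcon f
    refine Finset.mem_biUnion.2 ⟨(X, Y), by simp [I, hX, hY], ?_⟩
    simp only [bad, Finset.mem_filter, Finset.mem_univ, true_and, Finset.mem_compl]
    exact h
  have h1 := (Finset.card_le_card hcov).trans Finset.card_biUnion_le
  have htot : (Finset.univ : Finset (β → Fin d → α)).card = a ^ (d * b) := by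
    rw [Finset.card_univ]; simp [← pow_mul, ← hadef, ← hbdef]
  rw [htot] at h1
  have h1' : ((a : ℝ)) ^ (d * b) ≤ ∑ p ∈ I, ((bad p).card : ℝ) := by exact_mod_cast h1
  have hapos : (0 : ℝ) < a := by exact_mod_cast ha
  have hqpos : (0 : ℝ) < q := by exact_mod_cast hq
  have hterm : ∀ p ∈ I, ((bad p).card : ℝ) ≤ a ^ (d * b) * (Real.exp (-2)) ^ b := by
    intro p hp
    simp only [I, Finset.mem_filter, Finset.mem_univ, true_and] at hp
    obtain ⟨hX, hY⟩ := hp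
    rw [card_constrained d p.1ᶜ p.2 (bad p) (fun f => by simp [bad])]
    have hYb : p.2.card ≤ b := Finset.card_le_univ _
    have hXa : p.1.card ≤ a := Finset.card_le_univ _
    rw [Finset.card_compl, ← hadef, ← hbdef]
    push_cast [Nat.cast_sub hXa]
    have e1 : (a : ℝ) - p.1.card ≤ a * (Real.exp (-(1 / q))) := by
      have : (a : ℝ) ≤ q * p.1.card := by exact_mod_cast hX
      have h2 : (a : ℝ) / q ≤ p.1.card := by rw [div_le_iff₀ hqpos]; linarith
      have h3 := Real.add_one_le_exp (-(1 / (q : ℝ)))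
      calc (a : ℝ) - p.1.card ≤ a * (-(1 / (q : ℝ)) + 1) := by
            have : (a : ℝ) * (-(1 / (q : ℝ)) + 1) = a - a / q := by field_simp; ring
            linarith
        _ ≤ _ := by gcongr
    have e0 : 0 ≤ (a : ℝ) - p.1.card := by
      have : (p.1.card : ℝ) ≤ a := by exact_mod_cast hXa
      linarith
    calc ((a : ℝ) - p.1.card) ^ (d * p.2.card) * a ^ (d * (b - p.2.card))
        ≤ (a * (Real.exp (-(1 / q)))) ^ (d * p.2.card) * a ^ (d * (b - p.2.card)) := by gcongr
      _ = a ^ (d * b) * (Real.exp (-(1 / q))) ^ (d * p.2.card) := by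
          rw [mul_pow, mul_right_comm, ← pow_add, ← mul_add, Nat.add_sub_cancel' hYb]
      _ ≤ a ^ (d * b) * (Real.exp (-2)) ^ b := by
          gcongr
          rw [← Real.exp_nat_mul, ← Real.exp_nat_mul]
          apply Real.exp_le_exp.2
          have : (b : ℝ) ≤ q * p.2.card := by exact_mod_cast hY
          rw [hd]; push_cast
          have e : (q * (2 * q) * p.2.card : ℝ) * -(1 / q) = - (2 * (q * p.2.card)) := by field_simp
          rw [e]; linarith
  have h2 := h1'.trans (Finset.sum_le_sum hterm)
  rw [Finset.sum_const, nsmul_eq_mul] at h2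
  have hI : (I.card : ℝ) ≤ 4 ^ b := by
    have : I.card ≤ 2 ^ a * 2 ^ b := by
      refine (Finset.card_le_univ _).trans ?_
      simp [← hadef, ← hbdef]
    have h3 : 2 ^ a * 2 ^ b ≤ 4 ^ b := by
      have : (4 : ℕ) ^ b = 2 ^ b * 2 ^ b := by rw [← mul_pow]; norm_num
      rw [this]; gcongr; omega
    exact_mod_cast this.trans h3
  have hpow : (0 : ℝ) < a ^ (d * b) := by positivity
  have h4 : (4 * Real.exp (-2)) ^ b < 1 := by
    apply pow_lt_one₀ (by positivity)
    · have h5 : Real.exp (-2) = (Real.exp 1 * Real.exp 1)⁻¹ := by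
        rw [← Real.exp_add, ← Real.exp_neg]; norm_num
      have h6 := Real.exp_one_gt_d9
      rw [h5, ← div_eq_mul_inv, div_lt_one (by positivity)]
      nlinarith
    · omega
  have h7 : (a : ℝ) ^ (d * b) ≤ a ^ (d * b) * (4 * Real.exp (-2)) ^ b := by
    calc (a : ℝ) ^ (d * b) ≤ _ := h2
      _ ≤ 4 ^ b * (a ^ (d * b) * (Real.exp (-2)) ^ b) := by gcongr
      _ = _ := by rw [mul_pow]; ring
  nlinarith

theorem pow_le_fact (s : ℕ) : (s : ℝ) ^ s / s.factorial ≤ 3 ^ s := by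
  have h := Real.pow_div_factorial_le_exp (s : ℝ) (by positivity) s
  refine h.trans ?_
  rw [← mul_one (s : ℝ), Real.exp_nat_mul]
  have := Real.exp_one_lt_d9
  gcongr
  linarith

theorem choose_le_real (n s : ℕ) (hs : 1 ≤ s) : (n.choose s : ℝ) ≤ (3 * n / s) ^ s := by
  have h1 : (n.choose s : ℝ) ≤ n ^ s / s.factorial := Nat.choose_le_pow_div s n
  have h2 := pow_le_fact s
  have hs' : (0 : ℝ) < s := by exact_mod_cast hs
  refine h1.trans ?_
  rw [div_le_iff₀ (by positivity)] at h2 ⊢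
  rw [div_pow, mul_pow]
  rw [div_mul_eq_mul_div, le_div_iff₀ (by positivity)]
  have : (0 : ℝ) ≤ (n : ℝ) ^ s := by positivity
  nlinarith

theorem E2 : ∃ d : ℕ, ∀ m n : ℕ, 1 ≤ m → n ≤ 2 * m → ∃ f : Fin n → Fin d → Fin m,
    ∀ (X : Finset (Fin n)) (Z : Finset (Fin m)), (∀ x ∈ X, ∀ j, f x j ∈ Z) → 4 * Z.card < m →
      X.card ≤ Z.card := by
  classical
  refine ⟨7, ?_⟩
  intro m n hm hn
  by_contra hcon
  push Not at hcon
  let J : Finset ℕ := (Finset.range m).filter (fun z => 1 ≤ z ∧ 4 * z < m)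
  let I : ℕ → Finset (Finset (Fin n) × Finset (Fin m)) := fun z =>
    Finset.powersetCard (z + 1) Finset.univ ×ˢ Finset.powersetCard z Finset.univ
  let bad : Finset (Fin n) × Finset (Fin m) → Finset (Fin n → Fin 7 → Fin m) := fun p =>
    Finset.univ.filter (fun f => ∀ y ∈ p.1, ∀ j, f y j ∈ p.2)
  have hcov : (Finset.univ : Finset (Fin n → Fin 7 → Fin m)) ⊆ J.biUnion (fun z => (I z).biUnion bad) := by
    intro f _
    obtain ⟨X, Z, h, hZ, hlt⟩ := hcon f
    obtain ⟨X', hX', hc⟩ := Finset.exists_subset_card_eq (show Z.card + 1 ≤ X.card from hlt)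
    have hne : X'.Nonempty := by rw [← Finset.card_pos]; omega
    obtain ⟨x, hx⟩ := hne
    have hz : 1 ≤ Z.card := Finset.card_pos.2 ⟨_, h x (hX' hx) 0⟩
    refine Finset.mem_biUnion.2 ⟨Z.card, ?_, Finset.mem_biUnion.2 ⟨(X', Z), ?_, ?_⟩⟩
    · simp only [J, Finset.mem_filter, Finset.mem_range]; omega
    · simp [I, hc]
    · simp only [bad, Finset.mem_filter, Finset.mem_univ, true_and]
      exact fun y hy j => h y (hX' hy) j
  have h1 := (Finset.card_le_card hcov).trans
    (Finset.card_biUnion_le.trans (Finset.sum_le_sum fun z _ => Finset.card_biUnion_le))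
  have htot : (Finset.univ : Finset (Fin n → Fin 7 → Fin m)).card = m ^ (7 * n) := by
    rw [Finset.card_univ]; simp [← pow_mul]
  rw [htot] at h1
  have h1' : ((m : ℝ)) ^ (7 * n) ≤ ∑ z ∈ J, ∑ p ∈ I z, ((bad p).card : ℝ) := by exact_mod_cast h1
  have hmpos : (0 : ℝ) < m := by exact_mod_cast hm
  have hterm : ∀ z ∈ J, ∑ p ∈ I z, ((bad p).card : ℝ) ≤ m ^ (7 * n) * (1 / 4) ^ (z + 1) := by
    intro z hz
    simp only [J, Finset.mem_filter, Finset.mem_range] at hz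
    by_cases hzn : z + 1 ≤ n
    swap
    · have : I z = ∅ := by
        simp only [I]
        rw [Finset.powersetCard_eq_empty.2 (by simp; omega)]
        simp
      rw [this]; simp
    have hb : ∀ p ∈ I z, ((bad p).card : ℝ) = (z : ℝ) ^ (7 * (z + 1)) * m ^ (7 * (n - (z + 1))) := by
      intro p hp
      simp only [I, Finset.mem_product, Finset.mem_powersetCard, Finset.subset_univ, true_and] at hp
      rw [card_constrained 7 p.2 p.1 (bad p) (fun f => by simp [bad]), hp.1, hp.2]
      simp
    rw [Finset.sum_congr rfl hb, Finset.sum_const, nsmul_eq_mul]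
    have hI : (I z).card = n.choose (z + 1) * m.choose z := by
      simp [I, Finset.card_product]
    rw [hI]
    push_cast
    have hzpos : (0 : ℝ) < z := by exact_mod_cast hz.2.1
    have hzm : 4 * (z : ℝ) ≤ m := by exact_mod_cast hz.2.2.le
    have c1 : (n.choose (z + 1) : ℝ) ≤ (6 * m / z) ^ (z + 1) := by
      refine (choose_le_real n (z + 1) (by omega)).trans ?_
      have : (n : ℝ) ≤ 2 * m := by exact_mod_cast hn
      push_cast
      gcongr ?_ ^ _
      apply div_le_div₀ (by positivity) (by linarith) hzpos (by linarith)
    have c2 : (m.choose z : ℝ) ≤ (3 * m / z) ^ (z + 1) := by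
      refine (choose_le_real m z hz.2.1).trans ?_
      apply pow_le_pow_right₀ _ (by omega)
      rw [le_div_iff₀ hzpos]; linarith
    have hsplit : (m : ℝ) ^ (7 * n) = m ^ (7 * (z + 1)) * m ^ (7 * (n - (z + 1))) := by
      rw [← pow_add, ← mul_add, Nat.add_sub_cancel' hzn]
    rw [hsplit]
    have key : (6 * m / z * (3 * m / z) * (z : ℝ) ^ 7) ≤ (m : ℝ) ^ 7 * (1 / 4) := by
      have : (6 * m / z * (3 * m / z) * (z : ℝ) ^ 7) = 18 * m ^ 2 * z ^ 5 := by field_simp; norm_num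
      rw [this]
      have h5 : (4 * (z : ℝ)) ^ 5 ≤ m ^ 5 := by gcongr
      have : 18 * (m : ℝ) ^ 2 * z ^ 5 = 18 / 1024 * (m ^ 2 * (4 * z) ^ 5) := by ring
      rw [this]
      have : (m : ℝ) ^ 2 * (4 * z) ^ 5 ≤ m ^ 2 * m ^ 5 := by gcongr
      have e : (m : ℝ) ^ 2 * m ^ 5 = m ^ 7 := by ring
      have : (0 : ℝ) < m ^ 7 := by positivity
      linarith
    calc (n.choose (z + 1) : ℝ) * m.choose z * ((z : ℝ) ^ (7 * (z + 1)) * m ^ (7 * (n - (z + 1))))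
        ≤ (6 * m / z) ^ (z + 1) * (3 * m / z) ^ (z + 1) * ((z : ℝ) ^ (7 * (z + 1)) * m ^ (7 * (n - (z + 1)))) := by
          gcongr
      _ = (6 * m / z * (3 * m / z) * (z : ℝ) ^ 7) ^ (z + 1) * m ^ (7 * (n - (z + 1))) := by
          rw [mul_pow, mul_pow, pow_mul]; ring
      _ ≤ ((m : ℝ) ^ 7 * (1 / 4)) ^ (z + 1) * m ^ (7 * (n - (z + 1))) := by gcongr
      _ = _ := by rw [mul_pow, ← pow_mul]; ring
  have h2 := h1'.trans (Finset.sum_le_sum hterm)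
  rw [← Finset.mul_sum] at h2
  have hgeo : ∑ z ∈ J, (1 / 4 : ℝ) ^ (z + 1) ≤ 1 / 2 := by
    have : ∀ k : ℕ, ∑ z ∈ Finset.range k, (1 / 4 : ℝ) ^ (z + 1) ≤ 1 / 2 - 1 / 2 * (1 / 4) ^ k := by
      intro k
      induction k with
      | zero => norm_num
      | succ k ih =>
        rw [Finset.sum_range_succ]
        have : (0 : ℝ) < (1 / 4) ^ k := by positivity
        rw [pow_succ]
        linarith
    refine (Finset.sum_le_sum_of_subset_of_nonneg (Finset.filter_subset _ _)
      (fun _ _ _ => by positivity)).trans ((this m).trans ?_)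
    have : (0 : ℝ) < (1 / 4) ^ m := by positivity
    linarith
  have hpos : (0 : ℝ) < (m : ℝ) ^ (7 * n) := by positivity
  nlinarith


/-- the core statement -/
def CoreP : Prop := ∃ c q : ℕ, ∀ n, 1 ≤ n →
  ∃ (V E σ : Type) (_ : Fintype V) (_ : Fintype E) (_ : Fintype σ) (src tgt : E → V) (rk : V → ℕ)
    (so si : σ → V), n ≤ Fintype.card σ ∧ Fintype.card σ ≤ c * n ∧ Fintype.card V ≤ c * n ∧
    Fintype.card E ≤ c * n ∧ (∀ e, rk (src e) < rk (tgt e)) ∧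
    ∀ D : Finset V, D.card ≤ n → ∃ A B : Finset σ, Fintype.card σ ≤ q * A.card ∧
      Fintype.card σ ≤ q * B.card ∧ ∀ a ∈ A, ∀ b ∈ B, RR src tgt D (so a) (si b)

theorem cnt_in {n : ℕ} {W : Type} [DecidableEq W] (D D' : Finset W) (g : Fin n → W)
    (hg : Function.Injective g) (hD : D' ⊆ D) (hdis : ∀ a, g a ∉ D') (X : Finset (Fin n))
    (hX : X.card ≤ D'.card) :
    n ≤ (Finset.univ.filter (fun a => g a ∉ D ∧ a ∉ X)).card + D.card := by
  have h1 : (Finset.univ : Finset (Fin n)) ⊆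
      (Finset.univ.filter (fun a => g a ∉ D ∧ a ∉ X)) ∪
      ((Finset.univ.filter (fun a => g a ∈ D)) ∪ X) := by
    intro a _
    simp only [Finset.mem_union, Finset.mem_filter, Finset.mem_univ, true_and]
    tauto
  have h2 := (Finset.card_le_card h1).trans (Finset.card_union_le _ _)
  have h3 := Finset.card_union_le (Finset.univ.filter (fun a => g a ∈ D)) X
  have h4 : ((Finset.univ.filter (fun a => g a ∈ D)).image g ∪ D').card ≤ D.card := by
    apply Finset.card_le_card
    intro x hx
    rcases Finset.mem_union.1 hx with hx | hx
    · obtain ⟨a, ha, rfl⟩ := Finset.mem_image.1 hx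
      exact (Finset.mem_filter.1 ha).2
    · exact hD hx
  rw [Finset.card_union_of_disjoint, Finset.card_image_of_injective _ hg] at h4
  · simp only [Finset.card_univ, Fintype.card_fin] at h2
    omega
  · rw [Finset.disjoint_left]
    intro x hx
    obtain ⟨a, ha, rfl⟩ := Finset.mem_image.1 hx
    exact hdis a

theorem GdP_one (c : ℕ) (hc : 2 ≤ c) : GdP c 1 := by
  refine ⟨Bool, Unit, inferInstance, inferInstance, fun _ => false, fun _ => true,
    fun b => if b then 1 else 0, fun _ => false, fun _ => true,
    Function.injective_of_subsingleton _, Function.injective_of_subsingleton _, by simp,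
    by simp; omega, by simp; omega, ?_⟩
  intro D
  by_cases hD : D = ∅
  · subst hD
    refine ⟨Finset.univ, Finset.univ, by simp, by simp, ?_⟩
    intro a _ b _
    exact ⟨by simp, ReflTransGen.single ⟨⟨(), rfl, rfl⟩, by simp⟩⟩
  · have := Finset.card_pos.2 (Finset.nonempty_iff_ne_empty.2 hD)
    exact ⟨∅, ∅, by rw [Finset.card_empty]; omega, by rw [Finset.card_empty]; omega, by simp⟩

theorem RR_lift {V E V' E' : Type} (src tgt : E → V) (src' tgt' : E' → V') (D : Finset V)
    (D' : Finset V') (φ : V → V') (ψ : E → E') (h1 : ∀ e, src' (ψ e) = φ (src e))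
    (h2 : ∀ e, tgt' (ψ e) = φ (tgt e)) (hD : ∀ v, v ∉ D → φ v ∉ D') {u v : V}
    (h : RR src tgt D u v) : RR src' tgt' D' (φ u) (φ v) := by
  refine ⟨hD _ h.1, h.2.lift φ ?_⟩
  rintro a b ⟨⟨e, rfl, rfl⟩, h4⟩
  exact ⟨⟨ψ e, h1 e, h2 e⟩, hD _ h4⟩

theorem RR_trans {V E : Type} (src tgt : E → V) (D : Finset V) {u v w : V}
    (h : RR src tgt D u v) (h' : RR src tgt D v w) : RR src tgt D u w :=
  ⟨h.1, h.2.trans h'.2⟩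

theorem RR_notin {V E : Type} (src tgt : E → V) (D : Finset V) {u v : V}
    (h : RR src tgt D u v) : v ∉ D := by
  obtain ⟨h1, h2⟩ := h
  induction h2 with
  | refl => exact h1
  | tail _ h _ => exact h.2

theorem RR_edge {V E : Type} (src tgt : E → V) (D : Finset V) (e : E)
    (h : src e ∉ D) (h' : tgt e ∉ D) : RR src tgt D (src e) (tgt e) :=
  ⟨h, ReflTransGen.single ⟨⟨e, rfl, rfl⟩, h'⟩⟩

theorem GdP_step (c0 q d1 d2 c n : ℕ) (hn : 2 ≤ n)
    (hE1 : ∀ (α β : Type) [Fintype α] [Fintype β],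
    Fintype.card α ≤ Fintype.card β → 0 < Fintype.card α →
    ∃ f : β → Fin d1 → α, ∀ (X : Finset α) (Y : Finset β), Fintype.card α ≤ (q + 16) * X.card →
      Fintype.card β ≤ (q + 16) * Y.card → ∃ y ∈ Y, ∃ j, f y j ∈ X)
    (hE2 : ∀ m n : ℕ, 1 ≤ m → n ≤ 2 * m → ∃ f : Fin n → Fin d2 → Fin m,
    ∀ (X : Finset (Fin n)) (Z : Finset (Fin m)), (∀ x ∈ X, ∀ j, f x j ∈ Z) → 4 * Z.card < m →
      X.card ≤ Z.card)
    (hcore : ∃ (V E σ : Type) (_ : Fintype V) (_ : Fintype E) (_ : Fintype σ) (src tgt : E → V) (rk : V → ℕ)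
    (so si : σ → V), n ≤ Fintype.card σ ∧ Fintype.card σ ≤ c0 * n ∧ Fintype.card V ≤ c0 * n ∧
    Fintype.card E ≤ c0 * n ∧ (∀ e, rk (src e) < rk (tgt e)) ∧
    ∀ D : Finset V, D.card ≤ n → ∃ A B : Finset σ, Fintype.card σ ≤ q * A.card ∧
      Fintype.card σ ≤ q * B.card ∧ ∀ a ∈ A, ∀ b ∈ B, RR src tgt D (so a) (si b))
    (hc : c = 4 * (c0 + 2 + 2 * d2 + 2 * d1 * c0))
    (hm : GdP c ((n + 1) / 2)) : GdP c n := by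
  classical
  set m := (n + 1) / 2 with hmdef
  obtain ⟨Vc, Ec, σ, _, _, _, srcC, tgtC, rkC, so, si, hσ1, hσ2, hVc, hEc, hrkC, hC⟩ := hcore
  obtain ⟨Vm, Em, _, _, srcM, tgtM, rkM, inpM, outM, hiM, hoM, hrkM, hVm, hEm, hM⟩ := hm
  obtain ⟨f, hf⟩ := hE2 m n (by omega) (by omega)
  obtain ⟨g, hg⟩ := hE1 (Fin n) σ (by simpa using hσ1) (by simp; omega)
  simp only [Fintype.card_fin] at hg
  let V := (Fin n ⊕ Fin n) ⊕ (Vm ⊕ Vc)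
  let E := (Em ⊕ Ec) ⊕ ((Fin n × Fin d2) ⊕ (Fin n × Fin d2)) ⊕ ((σ × Fin d1) ⊕ (σ × Fin d1))
  let inn : Fin n → V := fun a => Sum.inl (Sum.inl a)
  let outn : Fin n → V := fun a => Sum.inl (Sum.inr a)
  let vm : Vm → V := fun a => Sum.inr (Sum.inl a)
  let vc : Vc → V := fun a => Sum.inr (Sum.inr a)
  let src : E → V := Sum.elim (Sum.elim (fun e => vm (srcM e)) (fun e => vc (srcC e)))
    (Sum.elim (Sum.elim (fun p => inn p.1) (fun p => vm (outM (f p.1 p.2))))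
      (Sum.elim (fun p => inn (g p.1 p.2)) (fun p => vc (si p.1))))
  let tgt : E → V := Sum.elim (Sum.elim (fun e => vm (tgtM e)) (fun e => vc (tgtC e)))
    (Sum.elim (Sum.elim (fun p => vm (inpM (f p.1 p.2))) (fun p => outn p.1))
      (Sum.elim (fun p => vc (so p.1)) (fun p => outn (g p.1 p.2))))
  let T : ℕ := ∑ v, rkM v + ∑ v, rkC v
  have hTM : ∀ v, rkM v ≤ T := fun v =>
    (Finset.single_le_sum (f := rkM) (fun _ _ => Nat.zero_le _) (Finset.mem_univ v)).trans (Nat.le_add_right _ _)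
  have hTC : ∀ v, rkC v ≤ T := fun v =>
    (Finset.single_le_sum (f := rkC) (fun _ _ => Nat.zero_le _) (Finset.mem_univ v)).trans (Nat.le_add_left _ _)
  let rk : V → ℕ := Sum.elim (Sum.elim (fun _ => 0) (fun _ => T + 2))
    (Sum.elim (fun v => rkM v + 1) (fun v => rkC v + 1))
  have hcm : c * m + (c0 + 2 + 2 * d2 + 2 * d1 * c0) * n ≤ c * n := by
    have h1 : 4 * m ≤ 3 * n := by omega
    rw [hc]
    nlinarith [Nat.zero_le (c0 + 2 + 2 * d2 + 2 * d1 * c0)]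
  refine ⟨V, E, inferInstance, inferInstance, src, tgt, rk, inn, outn, ?_, ?_, ?_, ?_, ?_, ?_⟩
  · intro a b h; exact Sum.inl_injective (Sum.inl_injective h)
  · intro a b h; exact Sum.inr_injective (Sum.inl_injective h)
  · rintro ((e | e) | ((e | e) | (e | e))) <;> simp only [src, tgt, rk, inn, outn, vm, vc, Sum.elim_inl, Sum.elim_inr]
    · have := hrkM e; omega
    · have := hrkC e; omega
    · omega
    · have := hTM (outM (f e.1 e.2)); omega
    · omega
    · have := hTC (si e.1); omega
  · simp only [V, Fintype.card_sum, Fintype.card_fin]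
    nlinarith [Nat.zero_le (d2 * n), Nat.zero_le (d1 * c0 * n)]
  · simp only [E, Fintype.card_sum, Fintype.card_fin, Fintype.card_prod]
    have : Fintype.card σ * d1 ≤ c0 * n * d1 := Nat.mul_le_mul_right _ hσ2
    nlinarith [Nat.zero_le (d2 * n), Nat.zero_le (d1 * c0 * n)]
  · intro D
    by_cases hDn : n ≤ D.card
    · exact ⟨∅, ∅, by simp; omega, by simp; omega, by simp⟩
    push Not at hDn
    let DM : Finset Vm := Finset.univ.filter (fun v => vm v ∈ D)
    let DC : Finset Vc := Finset.univ.filter (fun v => vc v ∈ D)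
    have hvm : Function.Injective vm := fun a b h => Sum.inl_injective (Sum.inr_injective h)
    have hvc : Function.Injective vc := fun a b h => Sum.inr_injective (Sum.inr_injective h)
    have hDMs : DM.image vm ⊆ D := by
      intro x hx
      obtain ⟨v, hv, rfl⟩ := Finset.mem_image.1 hx
      exact (Finset.mem_filter.1 hv).2
    have hDMc : (DM.image vm).card = DM.card := Finset.card_image_of_injective _ hvm
    have hin : Function.Injective inn := fun a b h => Sum.inl_injective (Sum.inl_injective h)
    have hout : Function.Injective outn := fun a b h => Sum.inr_injective (Sum.inl_injective h)
    have count1 : ∀ X : Finset (Fin n), X.card ≤ DM.card →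
        n ≤ (Finset.univ.filter (fun a => inn a ∉ D ∧ a ∉ X)).card + D.card := by
      intro X hX
      exact cnt_in D (DM.image vm) inn hin hDMs (by intro a; simp [inn, vm]) X (by rw [hDMc]; exact hX)
    have count2 : ∀ X : Finset (Fin n), X.card ≤ DM.card →
        n ≤ (Finset.univ.filter (fun a => outn a ∉ D ∧ a ∉ X)).card + D.card := by
      intro X hX
      exact cnt_in D (DM.image vm) outn hout hDMs (by intro a; simp [outn, vm]) X (by rw [hDMc]; exact hX)
    by_cases hk : 4 * DM.card < m
    · obtain ⟨A', B', hA', hB', hAB⟩ := hM DM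
      have sub : ∀ A' : Finset (Fin m), m ≤ A'.card + DM.card →
          (Finset.univ.filter (fun a => ∀ j, f a j ∉ A')).card ≤ DM.card := by
        intro A' hA'
        have e : A'ᶜ.card ≤ DM.card := by
          rw [Finset.card_compl, Fintype.card_fin]; omega
        refine (hf _ A'ᶜ ?_ (by omega)).trans e
        intro x hx j
        rw [Finset.mem_compl]
        exact (Finset.mem_filter.1 hx).2 j
      refine ⟨_, _, count1 _ (sub A' hA'), count2 _ (sub B' hB'), ?_⟩
      intro a ha b hb
      simp only [Finset.mem_filter, Finset.mem_univ, true_and, not_forall, not_not] at ha hb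
      obtain ⟨ha1, j, hj⟩ := ha
      obtain ⟨hb1, l, hl⟩ := hb
      have hr := hAB _ hj _ hl
      have hr' : RR src tgt D (vm (inpM (f a j))) (vm (outM (f b l))) :=
        RR_lift srcM tgtM src tgt DM D vm (fun e => Sum.inl (Sum.inl e)) (fun _ => rfl) (fun _ => rfl)
          (fun v hv h => hv (by simp [DM, h])) hr
      have e1 : RR src tgt D (inn a) (vm (inpM (f a j))) :=
        RR_edge src tgt D (Sum.inr (Sum.inl (Sum.inl (a, j)))) ha1 hr'.1
      have e2 : RR src tgt D (vm (outM (f b l))) (outn b) :=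
        RR_edge src tgt D (Sum.inr (Sum.inl (Sum.inr (b, l)))) (RR_notin _ _ _ hr') hb1
      exact RR_trans _ _ _ e1 (RR_trans _ _ _ hr' e2)
    · have hDCs : DC.image vc ⊆ D := by
        intro x hx
        obtain ⟨v, hv, rfl⟩ := Finset.mem_image.1 hx
        exact (Finset.mem_filter.1 hv).2
      have hDCc : DC.card ≤ D.card := by
        rw [← Finset.card_image_of_injective DC hvc]; exact Finset.card_le_card hDCs
      obtain ⟨A', B', hA', hB', hAB⟩ := hC DC (by omega)
      have sub : ∀ A' : Finset σ, Fintype.card σ ≤ q * A'.card →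
          (Finset.univ.filter (fun a => ∀ s ∈ A', ∀ j, g s j ≠ a)).card ≤ DM.card := by
        intro A' hA'
        by_contra hlt
        push Not at hlt
        have h16 : n ≤ 16 * (Finset.univ.filter (fun a => ∀ s ∈ A', ∀ j, g s j ≠ a)).card := by omega
        obtain ⟨y, hy, j, hj⟩ := hg (Finset.univ.filter (fun a => ∀ s ∈ A', ∀ j, g s j ≠ a)) A'
          (h16.trans (Nat.mul_le_mul_right _ (by omega))) (by nlinarith)
        exact (Finset.mem_filter.1 hj).2 y hy j rfl
      refine ⟨_, _, count1 _ (sub A' hA'), count2 _ (sub B' hB'), ?_⟩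
      intro a ha b hb
      simp only [Finset.mem_filter, Finset.mem_univ, true_and, not_forall, not_not] at ha hb
      obtain ⟨ha1, s, hs, j, rfl⟩ := ha
      obtain ⟨hb1, s', hs', l, rfl⟩ := hb
      have hr := hAB _ hs _ hs'
      have hr' : RR src tgt D (vc (so s)) (vc (si s')) :=
        RR_lift srcC tgtC src tgt DC D vc (fun e => Sum.inl (Sum.inr e)) (fun _ => rfl) (fun _ => rfl)
          (fun v hv h => hv (by simp [DC, h])) hr
      have e1 : RR src tgt D (inn (g s j)) (vc (so s)) :=
        RR_edge src tgt D (Sum.inr (Sum.inr (Sum.inl (s, j)))) ha1 hr'.1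
      have e2 : RR src tgt D (vc (si s')) (outn (g s' l)) :=
        RR_edge src tgt D (Sum.inr (Sum.inr (Sum.inr (s', l)))) (RR_notin _ _ _ hr') hb1
      exact RR_trans _ _ _ e1 (RR_trans _ _ _ hr' e2)

theorem GdP_of_core (h : CoreP) : ∃ c : ℕ, ∀ n, 1 ≤ n → GdP c n := by
  obtain ⟨c0, q, hcore⟩ := h
  obtain ⟨d1, hE1⟩ := E1 (q + 16) (by omega)
  obtain ⟨d2, hE2⟩ := E2
  refine ⟨4 * (c0 + 2 + 2 * d2 + 2 * d1 * c0), ?_⟩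
  intro n
  induction n using Nat.strong_induction_on with
  | _ n ih =>
    intro hn
    by_cases h1 : n = 1
    · subst h1; exact GdP_one _ (by omega)
    · exact GdP_step c0 q d1 d2 _ n (by omega) hE1 hE2 (hcore n hn) rfl
        (ih _ (by omega) (by omega))


/-- weight of one prediction -/
noncomputable def fac (x : ℝ) : Option Bool → Bool → ℝ
  | none, _ => 1
  | some c, y => if y = c then 2 / (1 + x) else 2 / (1 + x) * x

theorem fac_sum (x : ℝ) (hx : 0 < x) (o : Option Bool) : fac x o true + fac x o false = 2 := by
  have : 1 + x ≠ 0 := by positivity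
  rcases o with _ | c
  · simp [fac]; norm_num
  · cases c <;> simp [fac] <;> field_simp <;> ring

theorem coin_sum (x : ℝ) (hx : 0 < x) (b : ℕ) (pr : Fin b → (Fin b → Bool) → Option Bool)
    (hpr : ∀ t p p', (∀ s, s < t → p s = p' s) → pr t p = pr t p') :
    ∑ p : Fin b → Bool, ∏ t, fac x (pr t p) (p t) = 2 ^ b := by
  induction b with
  | zero => simp
  | succ b ih =>
    have e := Fin.consEquiv (fun _ : Fin (b + 1) => Bool)
    rw [← (Fin.consEquiv (fun _ : Fin (b + 1) => Bool)).sum_comp]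
    rw [Fintype.sum_prod_type]
    have h1 : ∀ y : Bool, ∑ p' : Fin b → Bool, ∏ t : Fin (b + 1),
        fac x (pr t (Fin.consEquiv (fun _ : Fin (b + 1) => Bool) (y, p')))
          (Fin.consEquiv (fun _ : Fin (b + 1) => Bool) (y, p') t) =
        fac x (pr 0 (fun _ => false)) y * 2 ^ b := by
      intro y
      rw [← ih (fun t p' => pr t.succ (Fin.cons y p')) ?_, Finset.mul_sum]
      · apply Finset.sum_congr rfl
        intro p' _
        rw [Fin.prod_univ_succ]
        simp only [Fin.consEquiv, Equiv.coe_fn_mk, Fin.cons_zero, Fin.cons_succ]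
        congr 2
        apply hpr
        intro s hs
        exact absurd hs (Fin.not_lt_zero s)
      · intro t p p' h
        apply hpr
        intro s hs
        refine Fin.cases ?_ (fun s' => ?_) s hs
        · intro _; rfl
        · intro hs'
          simp only [Fin.cons_succ]
          exact h s' (Fin.succ_lt_succ_iff.1 hs')
    simp only [h1]
    rw [Fintype.sum_bool, ← add_mul, fac_sum x hx, pow_succ]; ring

theorem coin (n b : ℕ) (hb : b = 16384 * n) (C : ℕ) (pr : Fin b → (Fin b → Bool) → Option Bool)
    (hpr : ∀ t p p', (∀ s, s < t → p s = p' s) → pr t p = pr t p') :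
    (Finset.univ.filter (fun p : Fin b → Bool =>
      C ≤ (Finset.univ.filter (fun t => pr t p ≠ none)).card ∧
      (Finset.univ.filter (fun t => pr t p = some (! p t))).card ≤ 2 * n)).card * 2 ^ C
      ≤ 2 ^ (b + 30 * n) := by
  set Q := (Finset.univ.filter (fun p : Fin b → Bool =>
      C ≤ (Finset.univ.filter (fun t => pr t p ≠ none)).card ∧
      (Finset.univ.filter (fun t => pr t p = some (! p t))).card ≤ 2 * n)) with hQ
  by_cases hC : b < C
  · have : Q = ∅ := by
      apply Finset.filter_eq_empty_iff.2
      rintro p _ ⟨h, _⟩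
      have : (Finset.univ.filter (fun t => pr t p ≠ none)).card ≤ b := by
        simpa using Finset.card_le_univ (Finset.univ.filter (fun t => pr t p ≠ none))
      omega
    rw [this]; simp
  push Not at hC
  set x : ℝ := 1 / 16384 with hx
  have hx0 : 0 < x := by rw [hx]; norm_num
  have hsum := coin_sum x hx0 b pr hpr
  have hfac : ∀ o y, 0 ≤ fac x o y := by
    intro o y
    rcases o with _ | c
    · simp [fac]
    · simp only [fac]; split_ifs <;> positivity
  have hw1 : (1 : ℝ) ≤ 2 / (1 + x) := by rw [hx]; norm_num
  have hprod : ∀ p ∈ Q, (2 / (1 + x)) ^ C * x ^ (2 * n) ≤ ∏ t, fac x (pr t p) (p t) := by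
    intro p hp
    obtain ⟨h1, h2⟩ := (Finset.mem_filter.1 hp).2
    have : ∀ t, fac x (pr t p) (p t) = (if pr t p ≠ none then 2 / (1 + x) else 1) *
        (if pr t p = some (! p t) then x else 1) := by
      intro t
      rcases hc : pr t p with _ | c
      · simp [fac]
      · cases c <;> cases hpt : p t <;> simp [fac]
    simp only [this]
    rw [Finset.prod_mul_distrib, Finset.prod_ite, Finset.prod_ite]
    simp only [Finset.prod_const, one_pow, mul_one]
    gcongr ?_ * ?_
    · exact pow_le_pow_right₀ hw1 h1
    · exact pow_le_pow_of_le_one hx0.le (by rw [hx]; norm_num) h2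
  have h3 : (Q.card : ℝ) * ((2 / (1 + x)) ^ C * x ^ (2 * n)) ≤ 2 ^ b := by
    rw [← hsum, ← nsmul_eq_mul, ← Finset.sum_const]
    refine (Finset.sum_le_sum hprod).trans ?_
    exact Finset.sum_le_sum_of_subset_of_nonneg (Finset.subset_univ _)
      (fun p _ _ => Finset.prod_nonneg fun t _ => hfac _ _)
  have h4 : (1 + x) ^ C ≤ 4 ^ n := by
    calc (1 + x) ^ C ≤ (1 + x) ^ b := pow_le_pow_right₀ (by linarith) hC
      _ = ((1 + x) ^ 16384) ^ n := by rw [hb, pow_mul]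
      _ ≤ 4 ^ n := by
        gcongr
        have h5 : 1 + x ≤ Real.exp x := by linarith [Real.add_one_le_exp x]
        calc (1 + x) ^ 16384 ≤ (Real.exp x) ^ 16384 := by gcongr
          _ = Real.exp 1 := by
            rw [← Real.exp_nat_mul]; congr 1; rw [hx]; norm_num
          _ ≤ 4 := by linarith [Real.exp_one_lt_d9]
  have h6 : (Q.card : ℝ) * 2 ^ C ≤ 2 ^ b * 2 ^ (30 * n) := by
    have e : (2 / (1 + x)) ^ C * x ^ (2 * n) = 2 ^ C / ((1 + x) ^ C * 2 ^ (28 * n)) := by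
      rw [div_pow, hx]
      have : ((1 : ℝ) / 16384) ^ (2 * n) = 1 / 2 ^ (28 * n) := by
        rw [div_pow, one_pow, show (16384 : ℝ) = 2 ^ 14 by norm_num, ← pow_mul]; congr 2; ring
      rw [this]
      field_simp
    rw [e] at h3
    rw [← mul_div_assoc, div_le_iff₀ (by positivity)] at h3
    refine h3.trans ?_
    have : (4 : ℝ) ^ n * 2 ^ (28 * n) = 2 ^ (30 * n) := by
      rw [show (4 : ℝ) = 2 ^ 2 by norm_num, ← pow_mul, ← pow_add]; congr 1; ring
    rw [← this]
    gcongr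
  rw [pow_add]
  exact_mod_cast h6


/-- points -/
abbrev PB (b : ℕ) : Type := Fin b → Bool
/-- vertices -/
abbrev VB (b : ℕ) : Type := PB b × Fin b × Fin b

/-- tails -/
def Tb {b : ℕ} (t : Fin b) (p : PB b) : Finset (VB b) :=
  Finset.univ.filter (fun v => v.2.2 = t ∧ v.1 t = false ∧ ∀ s, s < t → v.1 s = p s)

/-- heads -/
def Hb {b : ℕ} (t : Fin b) (p : PB b) : Finset (VB b) :=
  Finset.univ.filter (fun v => v.2.1 = t ∧ v.1 t = true ∧ ∀ s, s < t → v.1 s = p s)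

theorem mem_Tb {b : ℕ} (t : Fin b) (p : PB b) (v : VB b) :
    v ∈ Tb t p ↔ v.2.2 = t ∧ v.1 t = false ∧ ∀ s, s < t → v.1 s = p s := by simp [Tb]

theorem mem_Hb {b : ℕ} (t : Fin b) (p : PB b) (v : VB b) :
    v ∈ Hb t p ↔ v.2.1 = t ∧ v.1 t = true ∧ ∀ s, s < t → v.1 s = p s := by simp [Hb]

theorem Tb_congr {b : ℕ} (t : Fin b) (p p' : PB b) (h : ∀ s, s < t → p s = p' s) :
    Tb t p = Tb t p' := by
  ext v
  rw [mem_Tb, mem_Tb]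
  refine and_congr_right fun _ => and_congr_right fun _ => forall₂_congr fun s hs => ?_
  rw [h s hs]

theorem Hb_congr {b : ℕ} (t : Fin b) (p p' : PB b) (h : ∀ s, s < t → p s = p' s) :
    Hb t p = Hb t p' := by
  ext v
  rw [mem_Hb, mem_Hb]
  refine and_congr_right fun _ => and_congr_right fun _ => forall₂_congr fun s hs => ?_
  rw [h s hs]

theorem card_Tb_Hb {b : ℕ} (t : Fin b) (p : PB b) : (Tb t p).card = (Hb t p).card := by
  refine Finset.card_nbij' (fun v => (Function.update v.1 t true, v.2.2, v.2.1))
    (fun v => (Function.update v.1 t false, v.2.2, v.2.1)) ?_ ?_ ?_ ?_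
  · intro v hv
    have hv := (mem_Tb t p v).1 hv
    refine (mem_Hb t p _).2 ⟨hv.1, by simp, fun s hs => ?_⟩
    rw [← hv.2.2 s hs]
    simp [Function.update_of_ne hs.ne]
  · intro v hv
    have hv := (mem_Hb t p v).1 hv
    refine (mem_Tb t p _).2 ⟨hv.1, by simp, fun s hs => ?_⟩
    rw [← hv.2.2 s hs]
    simp [Function.update_of_ne hs.ne]
  · intro v hv
    have hv := (mem_Tb t p v).1 hv
    ext <;> simp [← hv.2.1]
  · intro v hv
    have hv := (mem_Hb t p v).1 hv
    ext <;> simp [← hv.2.1]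

theorem Tb_nonempty {b : ℕ} (t : Fin b) (p : PB b) : (Tb t p).Nonempty :=
  ⟨(Function.update p t false, t, t), (mem_Tb t p _).2 ⟨rfl, by simp, fun s hs => by
    simp [Function.update_of_ne hs.ne]⟩⟩

/-- expander property of the neighbor function -/
def NbOK (b q d : ℕ) (nb : VB b → Fin d → VB b) : Prop :=
  (∀ v j, v.1 v.2.1 = true → nb v j ∈ Tb v.2.1 v.1) ∧
  ∀ t p, ∀ X ⊆ Tb t p, ∀ Y ⊆ Hb t p, (Tb t p).card ≤ q * X.card → (Hb t p).card ≤ q * Y.card →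
    ∃ y ∈ Y, ∃ j, nb y j ∈ X

theorem exists_nb (q : ℕ) (hq : 1 ≤ q) : ∃ d, ∀ b, ∃ nb : VB b → Fin d → VB b, NbOK b q d nb := by
  classical
  obtain ⟨d, hd⟩ := E1 q hq
  refine ⟨d, fun b => ?_⟩
  have key : ∀ T H : Finset (VB b), ∃ f : VB b → Fin d → VB b, T.card = H.card → T.Nonempty →
      (∀ v ∈ H, ∀ j, f v j ∈ T) ∧ ∀ X ⊆ T, ∀ Y ⊆ H, T.card ≤ q * X.card → H.card ≤ q * Y.card →
        ∃ y ∈ Y, ∃ j, f y j ∈ X := by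
    intro T H
    by_cases hTH : T.card = H.card ∧ T.Nonempty
    swap
    · exact ⟨fun v _ => v, fun h1 h2 => absurd ⟨h1, h2⟩ hTH⟩
    obtain ⟨h1, h2⟩ := hTH
    obtain ⟨f, hf⟩ := hd T H (by simp [h1]) (by simpa using h2)
    simp only [Fintype.card_coe] at hf
    refine ⟨fun v j => if hv : v ∈ H then (f ⟨v, hv⟩ j).1 else v, fun _ _ => ⟨?_, ?_⟩⟩
    · intro v hv j
      simp [hv]
    · intro X hX Y hY hXc hYc
      obtain ⟨y, hy, j, hj⟩ := hf (X.subtype (· ∈ T)) (Y.subtype (· ∈ H))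
        (by rw [Finset.card_subtype, Finset.filter_true_of_mem (fun x hx => hX hx)]; exact hXc)
        (by rw [Finset.card_subtype, Finset.filter_true_of_mem (fun x hx => hY hx)]; exact hYc)
      refine ⟨y.1, by simpa using hy, j, ?_⟩
      beta_reduce
      rw [dif_pos y.2]
      simpa using hj
  choose F hF using key
  refine ⟨fun v j => F (Tb v.2.1 v.1) (Hb v.2.1 v.1) v j, ?_, ?_⟩
  · intro v j hv
    refine (hF _ _ (card_Tb_Hb _ _) (Tb_nonempty _ _)).1 v ?_ j
    exact (mem_Hb _ _ _).2 ⟨rfl, hv, fun _ _ => rfl⟩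
  · intro t p X hX Y hY hXc hYc
    obtain ⟨y, hy, j, hj⟩ := (hF _ _ (card_Tb_Hb t p) (Tb_nonempty _ _)).2 X hX Y hY hXc hYc
    refine ⟨y, hy, j, ?_⟩
    have h1 := (mem_Hb _ _ _).1 (hY hy)
    obtain ⟨rfl, h2, h3⟩ := h1
    have e1 := Tb_congr y.2.1 y.1 p h3
    have e2 := Hb_congr y.2.1 y.1 p h3
    show F (Tb y.2.1 y.1) (Hb y.2.1 y.1) y j ∈ X
    rw [e1, e2]
    exact hj

/-- adjacency -/
def BA {b d : ℕ} (nb : VB b → Fin d → VB b) (u v : VB b) : Prop :=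
  v.1 v.2.1 = true ∧ ∃ j, nb v j = u

/-- lexicographic order -/
def ltP {b : ℕ} (p p' : PB b) : Prop := ∃ t, (∀ s, s < t → p s = p' s) ∧ p t = false ∧ p' t = true

theorem ltP_irrefl {b : ℕ} (p : PB b) : ¬ ltP p p := by
  rintro ⟨t, _, h1, h2⟩; rw [h1] at h2; exact absurd h2 (by simp)

theorem ltP_trans {b : ℕ} {p p' p'' : PB b} (h : ltP p p') (h' : ltP p' p'') : ltP p p'' := by
  obtain ⟨t, h1, h2, h3⟩ := h
  obtain ⟨t', g1, g2, g3⟩ := h'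
  rcases lt_trichotomy t t' with hlt | rfl | hlt
  · exact ⟨t, fun s hs => (h1 s hs).trans (g1 s (hs.trans hlt)), h2, (g1 t hlt) ▸ h3⟩
  · rw [h3] at g2; exact absurd g2 (by simp)
  · exact ⟨t', fun s hs => (h1 s (hs.trans hlt)).trans (g1 s hs), (h1 t' hlt).trans g2, g3⟩

open Classical in
/-- rank -/
noncomputable def rkP {b : ℕ} (p : PB b) : ℕ := (Finset.univ.filter (fun p' => ltP p' p)).card

theorem rkP_lt {b : ℕ} {p p' : PB b} (h : ltP p p') : rkP p < rkP p' := by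
  classical
  apply Finset.card_lt_card
  rw [Finset.ssubset_iff_of_subset]
  · exact ⟨p, by simpa using h, by simpa using ltP_irrefl p⟩
  · intro x hx
    simp only [Finset.mem_filter, Finset.mem_univ, true_and] at hx ⊢
    exact ltP_trans hx h

theorem BA_lt {b q d : ℕ} {nb : VB b → Fin d → VB b} (h : NbOK b q d nb) {u v : VB b}
    (huv : BA nb u v) : rkP u.1 < rkP v.1 := by
  obtain ⟨h1, j, rfl⟩ := huv
  have := (mem_Tb _ _ _).1 (h.1 v j h1)
  exact rkP_lt ⟨v.2.1, this.2.2, this.2.1, h1⟩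

/-- alive reachability -/
def AR {b d : ℕ} (nb : VB b → Fin d → VB b) (S : Finset (VB b)) : VB b → VB b → Prop :=
  ReflTransGen (fun x y => BA nb x y ∧ x ∉ S ∧ y ∉ S)


theorem fiber_le {α κ : Type} [DecidableEq κ] [Fintype κ] (A B : Finset α) (f : α → κ) (q : ℕ)
    (h : ∀ k, q * (A.filter (fun a => f a = k)).card ≤ (B.filter (fun a => f a = k)).card) :
    q * A.card ≤ B.card := by
  rw [Finset.card_eq_sum_card_fiberwise (f := f) (s := A) (t := Finset.univ) (fun _ _ => Finset.mem_coe.2 (Finset.mem_univ _)),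
    Finset.card_eq_sum_card_fiberwise (f := f) (s := B) (t := Finset.univ) (fun _ _ => Finset.mem_coe.2 (Finset.mem_univ _)), Finset.mul_sum]
  exact Finset.sum_le_sum fun k _ => h k

/-- canonical prefix -/
def preP {b : ℕ} (t : Fin b) (p : PB b) : PB b := fun s => if s < t then p s else false

theorem preP_eq {b : ℕ} (t : Fin b) (p p' : PB b) :
    preP t p = preP t p' ↔ ∀ s, s < t → p s = p' s := by
  constructor
  · intro h s hs
    have := congrFun h s
    simpa [preP, hs] using this
  · intro h
    funext s
    by_cases hs : s < t
    · simp [preP, hs, h s hs]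
    · simp [preP, hs]

theorem TH {b q d : ℕ} {nb : VB b → Fin d → VB b} (hnb : NbOK b q d nb) (S : Finset (VB b)) (K : ℕ)
    (hin hout : VB b → ℕ) (hK : ∀ v, hin v ≤ K)
    (hmono : ∀ u v, BA nb u v → u ∉ S → v ∉ S → hin v ≤ hout u) :
    ∃ th : Fin b → PB b → ℕ, (∀ t p, th t p ≤ K) ∧
      (∀ t p p', (∀ s, s < t → p s = p' s) → th t p = th t p') ∧
      q * (Finset.univ.filter (fun v : VB b => v.1 v.2.1 = true ∧ v.1 v.2.2 = false ∧
        ¬ (v ∉ S ∧ hin v ≤ th v.2.1 v.1 ∧ th v.2.2 v.1 ≤ hout v))).card ≤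
        q * S.card + 2 * Fintype.card (VB b) := by
  classical
  let Pr : Fin b → PB b → ℕ → Prop := fun t p θ =>
    q * ((Tb t p).filter (fun v => v ∉ S ∧ hout v < θ)).card ≤ (Tb t p).card
  let th : Fin b → PB b → ℕ := fun t p => Nat.findGreatest (Pr t p) K
  have hcong : ∀ t p p', (∀ s, s < t → p s = p' s) → th t p = th t p' := by
    intro t p p' h
    have : Pr t p = Pr t p' := by
      funext θ; simp only [Pr]; rw [Tb_congr t p p' h]
    simp only [th]
    simp only [this]
  have h0 : ∀ t p, Pr t p (th t p) := by
    intro t p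
    apply Nat.findGreatest_spec (Nat.zero_le K)
    simp [Pr]
  have h1 : ∀ t p, q * ((Hb t p).filter (fun v => v ∉ S ∧ th t p < hin v)).card ≤ (Hb t p).card := by
    intro t p
    by_contra hcon
    push Not at hcon
    have hlt : th t p < K := by
      by_contra hge
      push Not at hge
      have : (Hb t p).filter (fun v => v ∉ S ∧ th t p < hin v) = ∅ := by
        apply Finset.filter_eq_empty_iff.2
        rintro v _ ⟨_, h⟩
        have := hK v
        omega
      rw [this] at hcon; simp at hcon
    have h2 : ¬ Pr t p (th t p + 1) := Nat.findGreatest_is_greatest (Nat.lt_succ_self _) hlt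
    simp only [Pr, not_le] at h2
    obtain ⟨y, hy, j, hj⟩ := hnb.2 t p _ (Finset.filter_subset (fun v => v ∉ S ∧ hout v < th t p + 1) _) _
      (Finset.filter_subset (fun v => v ∉ S ∧ th t p < hin v) _) h2.le hcon.le
    rw [Finset.mem_filter] at hy hj
    have hyH := (mem_Hb _ _ _).1 hy.1
    have := hmono (nb y j) y ⟨by rw [hyH.1]; exact hyH.2.1, j, rfl⟩ hj.2.1 hy.2.1
    omega
  refine ⟨th, fun t p => Nat.findGreatest_le _, hcong, ?_⟩
  set B1 := Finset.univ.filter (fun v : VB b => v.1 v.2.1 = true ∧ v ∉ S ∧ th v.2.1 v.1 < hin v) with hB1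
  set B2 := Finset.univ.filter (fun v : VB b => v.1 v.2.2 = false ∧ v ∉ S ∧ hout v < th v.2.2 v.1) with hB2
  have hsub : (Finset.univ.filter (fun v : VB b => v.1 v.2.1 = true ∧ v.1 v.2.2 = false ∧
        ¬ (v ∉ S ∧ hin v ≤ th v.2.1 v.1 ∧ th v.2.2 v.1 ≤ hout v))) ⊆ S ∪ (B1 ∪ B2) := by
    intro v hv
    simp only [hB1, hB2, Finset.mem_union, Finset.mem_filter, Finset.mem_univ, true_and] at hv ⊢
    obtain ⟨a1, a2, a3⟩ := hv
    by_cases hS : v ∈ S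
    · exact Or.inl hS
    · by_cases h5 : hin v ≤ th v.2.1 v.1
      · right; right
        refine ⟨a2, hS, ?_⟩
        by_contra h6
        exact a3 ⟨hS, h5, not_lt.1 h6⟩
      · right; left
        exact ⟨a1, hS, not_le.1 h5⟩
  have hc1 : q * B1.card ≤ Fintype.card (VB b) := by
    refine (fiber_le B1 (Finset.univ.filter (fun v : VB b => v.1 v.2.1 = true))
      (fun v => (v.2.1, preP v.2.1 v.1)) q ?_).trans (Finset.card_le_univ _)
    rintro ⟨t, r⟩
    by_cases hem : (B1.filter (fun v => (v.2.1, preP v.2.1 v.1) = (t, r))) = ∅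
    · rw [hem]; simp
    · obtain ⟨v0, hv0⟩ := Finset.nonempty_iff_ne_empty.2 hem
      simp only [Finset.mem_filter, Prod.mk.injEq] at hv0
      obtain ⟨_, rfl, rfl⟩ := hv0
      refine (Nat.mul_le_mul_left q (Finset.card_le_card ?_)).trans ((h1 v0.2.1 v0.1).trans
        (Finset.card_le_card ?_))
      · intro v hv
        simp only [hB1, Finset.mem_filter, Finset.mem_univ, true_and, Prod.mk.injEq] at hv
        obtain ⟨⟨a1, a2, a3⟩, a4, a5⟩ := hv
        rw [a4] at a1 a3 a5
        have a6 := (preP_eq _ _ _).1 a5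
        refine Finset.mem_filter.2 ⟨(mem_Hb _ _ _).2 ⟨a4, a1, a6⟩, a2, ?_⟩
        rw [← hcong _ _ _ a6]; exact a3
      · intro v hv
        have hv := (mem_Hb _ _ _).1 hv
        simp only [Finset.mem_filter, Finset.mem_univ, true_and, Prod.mk.injEq]
        rw [hv.1]
        exact ⟨hv.2.1, rfl, (preP_eq _ _ _).2 hv.2.2⟩
  have hc2 : q * B2.card ≤ Fintype.card (VB b) := by
    refine (fiber_le B2 (Finset.univ.filter (fun v : VB b => v.1 v.2.2 = false))
      (fun v => (v.2.2, preP v.2.2 v.1)) q ?_).trans (Finset.card_le_univ _)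
    rintro ⟨t, r⟩
    by_cases hem : (B2.filter (fun v => (v.2.2, preP v.2.2 v.1) = (t, r))) = ∅
    · rw [hem]; simp
    · obtain ⟨v0, hv0⟩ := Finset.nonempty_iff_ne_empty.2 hem
      simp only [Finset.mem_filter, Prod.mk.injEq] at hv0
      obtain ⟨_, rfl, rfl⟩ := hv0
      refine (Nat.mul_le_mul_left q (Finset.card_le_card ?_)).trans ((h0 v0.2.2 v0.1).trans
        (Finset.card_le_card ?_))
      · intro v hv
        simp only [hB2, Finset.mem_filter, Finset.mem_univ, true_and, Prod.mk.injEq] at hv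
        obtain ⟨⟨a1, a2, a3⟩, a4, a5⟩ := hv
        rw [a4] at a1 a3 a5
        have a6 := (preP_eq _ _ _).1 a5
        refine Finset.mem_filter.2 ⟨(mem_Tb _ _ _).2 ⟨a4, a1, a6⟩, a2, ?_⟩
        rw [← hcong _ _ _ a6]; exact a3
      · intro v hv
        have hv := (mem_Tb _ _ _).1 hv
        simp only [Finset.mem_filter, Finset.mem_univ, true_and, Prod.mk.injEq]
        rw [hv.1]
        exact ⟨hv.2.1, rfl, (preP_eq _ _ _).2 hv.2.2⟩
  have h3 := (Finset.card_le_card hsub).trans ((Finset.card_union_le _ _).trans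
    (Nat.add_le_add_left (Finset.card_union_le _ _) _))
  have h4 := Nat.mul_le_mul_left q h3
  rw [mul_add, mul_add] at h4
  omega

/-- slice -/
def sl {b : ℕ} (F : Finset (VB b)) (p : PB b) : Finset (Fin b × Fin b) :=
  Finset.univ.filter (fun io => (p, io) ∈ F)

theorem markovB {b : ℕ} (F : Finset (VB b)) (k : ℕ) :
    (Finset.univ.filter (fun p => k < (sl F p).card)).card * k ≤ F.card := by
  have h1 : F.card = ∑ p : PB b, (sl F p).card := by
    rw [Finset.card_eq_sum_card_fiberwise (f := Prod.fst) (s := F) (t := Finset.univ)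
      (fun _ _ => Finset.mem_coe.2 (Finset.mem_univ _))]
    apply Finset.sum_congr rfl
    intro p _
    symm
    refine Finset.card_nbij' (fun io => (p, io)) (fun v => v.2) ?_ ?_ ?_ ?_
    · intro io hio
      simp only [sl, Finset.coe_filter, Finset.mem_univ, true_and, Set.mem_setOf_eq] at hio
      simp [hio]
    · intro v hv
      simp only [Finset.coe_filter, Set.mem_setOf_eq] at hv
      obtain ⟨hv, rfl⟩ := hv
      simp [sl, hv]
    · intro io _; rfl
    · intro v hv
      simp only [Finset.coe_filter, Set.mem_setOf_eq] at hv
      obtain ⟨hv, rfl⟩ := hv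
      rfl
  rw [h1, ← smul_eq_mul, ← Finset.sum_const]
  refine (Finset.sum_le_sum (g := fun p => (sl F p).card) ?_).trans
    (Finset.sum_le_sum_of_subset (Finset.subset_univ _))
  intro p hp
  exact (Finset.mem_filter.1 hp).2.le


theorem card_PB (b : ℕ) : Fintype.card (PB b) = 2 ^ b := by simp

theorem card_VB (n b : ℕ) (hb : b = 16384 * n) : Fintype.card (VB b) = 2 ^ b * (2 ^ 28 * n ^ 2) := by
  simp only [Fintype.card_prod, Fintype.card_fin, card_PB]
  rw [hb]; ring

theorem THg {n b d : ℕ} (hn : 1 ≤ n) (hb : b = 16384 * n) {nb : VB b → Fin d → VB b}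
    (hnb : NbOK b (2 ^ 38) d nb) (S : Finset (VB b)) (hS : 2 ^ 37 * S.card ≤ Fintype.card (VB b)) (K : ℕ)
    (hin hout : VB b → ℕ) (hK : ∀ v, hin v ≤ K)
    (hmono : ∀ u v, BA nb u v → u ∉ S → v ∉ S → hin v ≤ hout u) :
    ∃ th : Fin b → PB b → ℕ, (∀ t p, th t p ≤ K) ∧
      (∀ t p p', (∀ s, s < t → p s = p' s) → th t p = th t p') ∧
      ∃ bad : Finset (PB b), 2 ^ 8 * bad.card ≤ 2 ^ b ∧ ∀ p, p ∉ bad →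
        (Finset.univ.filter (fun io : Fin b × Fin b => p io.1 = true ∧ p io.2 = false ∧
        ¬ ((p, io) ∉ S ∧ hin (p, io) ≤ th io.1 p ∧ th io.2 p ≤ hout (p, io)))).card ≤ n ^ 2 := by
  obtain ⟨th, h1, h2, h3⟩ := TH hnb S K hin hout hK hmono
  set F := (Finset.univ.filter (fun v : VB b => v.1 v.2.1 = true ∧ v.1 v.2.2 = false ∧
        ¬ (v ∉ S ∧ hin v ≤ th v.2.1 v.1 ∧ th v.2.2 v.1 ≤ hout v))) with hF
  refine ⟨th, h1, h2, Finset.univ.filter (fun p => n ^ 2 < (sl F p).card), ?_, ?_⟩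
  · have h4 := markovB F (n ^ 2)
    have h5 := card_VB n b hb
    set x := (Finset.univ.filter (fun p => n ^ 2 < (sl F p).card)).card
    have hn2 : 0 < n ^ 2 := by positivity
    have h6 : 2 ^ 38 * F.card ≤ 4 * Fintype.card (VB b) := by omega
    rw [h5] at h6
    have h7 : 2 ^ 38 * (x * n ^ 2) ≤ 4 * (2 ^ b * (2 ^ 28 * n ^ 2)) := (Nat.mul_le_mul_left _ h4).trans h6
    have h8 : (2 ^ 30 * n ^ 2) * (2 ^ 8 * x) ≤ (2 ^ 30 * n ^ 2) * 2 ^ b := by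
      calc (2 ^ 30 * n ^ 2) * (2 ^ 8 * x) = 2 ^ 38 * (x * n ^ 2) := by ring
        _ ≤ _ := h7
        _ = _ := by ring
    exact Nat.le_of_mul_le_mul_left h8 (by positivity)
  · intro p hp
    simp only [Finset.mem_filter, Finset.mem_univ, true_and, not_lt] at hp
    refine le_trans (Finset.card_le_card ?_) hp
    intro io hio
    simp only [Finset.mem_filter, Finset.mem_univ, true_and, sl, hF] at hio ⊢
    exact hio

theorem levelm {b : ℕ} (p : PB b) (th : Fin b → ℕ) (n L : ℕ) : ∃ m ≤ L,
    (Finset.univ.filter (fun i => p i = true ∧ th i < m)).card ≤ n ∧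
    (m = L ∨ n < (Finset.univ.filter (fun i => p i = true ∧ th i ≤ m)).card) := by
  classical
  let Pr : ℕ → Prop := fun m => (Finset.univ.filter (fun i => p i = true ∧ th i < m)).card ≤ n
  refine ⟨Nat.findGreatest Pr L, Nat.findGreatest_le _, ?_, ?_⟩
  · exact Nat.findGreatest_spec (P := Pr) (Nat.zero_le L) (by simp [Pr])
  · rcases (Nat.findGreatest_le (P := Pr) L).lt_or_eq with h | h
    · right
      have h2 : ¬ Pr (Nat.findGreatest Pr L + 1) := Nat.findGreatest_is_greatest (Nat.lt_succ_self _) h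
      simp only [Pr, not_le] at h2
      simpa [Nat.lt_succ_iff] using h2
    · exact Or.inl h

theorem exc_prod {b n : ℕ} (E : Finset (Fin b × Fin b)) (hE : E.card ≤ n ^ 2) (I O : Finset (Fin b))
    (hI : n < I.card) (h : ∀ i ∈ I, ∀ o ∈ O, (i, o) ∈ E) : O.card ≤ n := by
  by_contra hO
  push Not at hO
  have : I ×ˢ O ⊆ E := by
    rintro ⟨i, o⟩ hio
    exact h i (Finset.mem_product.1 hio).1 o (Finset.mem_product.1 hio).2
  have := Finset.card_le_card this
  rw [Finset.card_product] at this
  nlinarith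

open Classical in
/-- size of the reached set -/
noncomputable def rsc {b d : ℕ} (nb : VB b → Fin d → VB b) (S : Finset (VB b)) (v : VB b) : ℕ :=
  (Finset.univ.filter (fun w => AR nb S v w)).card

theorem AR_rk {b q d : ℕ} {nb : VB b → Fin d → VB b} (h : NbOK b q d nb) (S : Finset (VB b)) {u v : VB b}
    (huv : AR nb S u v) : rkP u.1 ≤ rkP v.1 := by
  induction huv with
  | refl => exact le_rfl
  | tail _ h1 ih => exact ih.trans (BA_lt h h1.1).le

theorem rsc_step {b q d : ℕ} {nb : VB b → Fin d → VB b} (h : NbOK b q d nb) (S : Finset (VB b)) {u v : VB b}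
    (huv : BA nb u v) (hu : u ∉ S) (hv : v ∉ S) : rsc nb S v + 1 ≤ rsc nb S u := by
  classical
  apply Finset.card_lt_card
  rw [Finset.ssubset_iff_of_subset]
  · refine ⟨u, Finset.mem_filter.2 ⟨Finset.mem_univ _, ReflTransGen.refl⟩, ?_⟩
    simp only [Finset.mem_filter, Finset.mem_univ, true_and]
    intro h1
    have := AR_rk h S h1
    have := BA_lt h huv
    omega
  · intro x hx
    simp only [Finset.mem_filter, Finset.mem_univ, true_and] at hx ⊢
    exact ReflTransGen.head ⟨huv, hu, hv⟩ hx

theorem depthL {n b d : ℕ} (hn : 10 ≤ n) (hb : b = 16384 * n) {nb : VB b → Fin d → VB b}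
    (hnb : NbOK b (2 ^ 38) d nb) (S : Finset (VB b)) (hS : 2 ^ 37 * S.card ≤ Fintype.card (VB b)) :
    ∃ bad : Finset (PB b), 2 ^ 7 * bad.card ≤ 2 ^ b ∧ ∀ p, p ∉ bad →
        (Finset.univ.filter (fun io : Fin b × Fin b => p io.1 = true ∧ p io.2 = false ∧
        ¬ ((p, io) ∉ S ∧ 2 ^ (b - 32 * n) ≤ rsc nb S (p, io)))).card ≤ 32 * n * b + n ^ 2 := by
  classical
  set L := 2 ^ (b - 32 * n) with hL
  obtain ⟨th, h1, h2, bad0, hbad0, hgood⟩ := THg (by omega) hb hnb S hS L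
    (fun v => min L (rsc nb S v + 1)) (fun v => min L (rsc nb S v)) (fun v => min_le_left _ _) (by
      intro u v huv hu hv
      have := rsc_step hnb S huv hu hv
      omega)
  let pr1 : Fin b → PB b → Option Bool := fun t p => if th t p < L then some false else none
  let pr2 : ℕ → Fin b → PB b → Option Bool := fun m t p => if th t p < m then some false else some true
  have hc1 := coin n b hb (32 * n) pr1 (by intro t p p' h; simp only [pr1]; rw [h2 t p p' h])
  have hc2 := fun m => coin n b hb b (pr2 m) (by intro t p p' h; simp only [pr2]; rw [h2 t p p' h])
  set bad1 := (Finset.univ.filter (fun p : Fin b → Bool =>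
      32 * n ≤ (Finset.univ.filter (fun t => pr1 t p ≠ none)).card ∧
      (Finset.univ.filter (fun t => pr1 t p = some (! p t))).card ≤ 2 * n)) with hbad1
  let bad2 : ℕ → Finset (PB b) := fun m => (Finset.univ.filter (fun p : Fin b → Bool =>
      b ≤ (Finset.univ.filter (fun t => pr2 m t p ≠ none)).card ∧
      (Finset.univ.filter (fun t => pr2 m t p = some (! p t))).card ≤ 2 * n))
  have k1 : bad1.card ≤ 2 ^ (b - 2 * n) := by
    have : bad1.card * 2 ^ (32 * n) ≤ 2 ^ (b - 2 * n) * 2 ^ (32 * n) := by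
      rw [← pow_add, show b - 2 * n + 32 * n = b + 30 * n by omega]; exact hc1
    exact Nat.le_of_mul_le_mul_right this (by positivity)
  have k2 : ∀ m, (bad2 m).card ≤ 2 ^ (30 * n) := by
    intro m
    have : (bad2 m).card * 2 ^ b ≤ 2 ^ (30 * n) * 2 ^ b := by
      rw [← pow_add, add_comm (30 * n)]; exact hc2 m
    exact Nat.le_of_mul_le_mul_right this (by positivity)
  have k3 : ((Finset.range L).biUnion bad2).card ≤ 2 ^ (b - 2 * n) := by
    refine Finset.card_biUnion_le.trans ((Finset.sum_le_card_nsmul _ _ _ (fun m _ => k2 m)).trans ?_)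
    rw [Finset.card_range, smul_eq_mul, hL, ← pow_add]
    exact Nat.pow_le_pow_right (by norm_num) (by omega)
  refine ⟨bad0 ∪ (bad1 ∪ (Finset.range L).biUnion bad2), ?_, ?_⟩
  · have h5 := (Finset.card_union_le bad0 (bad1 ∪ (Finset.range L).biUnion bad2)).trans
      (Nat.add_le_add_left (Finset.card_union_le _ _) _)
    have h6 : 2 ^ 9 * 2 ^ (b - 2 * n) ≤ 2 ^ b := by
      rw [← pow_add]; exact Nat.pow_le_pow_right (by norm_num) (by omega)
    omega
  · intro p hp
    simp only [Finset.mem_union, not_or] at hp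
    obtain ⟨hp0, hp1, hp2⟩ := hp
    have hE := hgood p hp0
    set E := (Finset.univ.filter (fun io : Fin b × Fin b => p io.1 = true ∧ p io.2 = false ∧
        ¬ ((p, io) ∉ S ∧ min L (rsc nb S (p, io) + 1) ≤ th io.1 p ∧ th io.2 p ≤ min L (rsc nb S (p, io))))) with hEdef
    obtain ⟨m, hmL, hm1, hm2⟩ := levelm p (fun t => th t p) n L
    by_cases hmL' : m = L
    · subst hmL'
      have hcnt : (Finset.univ.filter (fun t => th t p < L)).card < 32 * n := by
        by_contra hge
        push Not at hge
        apply hp1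
        rw [hbad1, Finset.mem_filter]
        refine ⟨Finset.mem_univ _, ?_, ?_⟩
        · refine hge.trans (Finset.card_le_card ?_)
          intro t ht
          simp only [Finset.mem_filter, Finset.mem_univ, true_and, pr1] at ht ⊢
          simp [ht]
        · refine le_trans (Finset.card_le_card ?_) (hm1.trans (by omega))
          intro t ht
          simp only [Finset.mem_filter, Finset.mem_univ, true_and, pr1] at ht ⊢
          split_ifs at ht with hlt
          simp only [Option.some.injEq] at ht
          refine ⟨?_, hlt⟩
          revert ht; cases p t <;> simp
      have hsub : (Finset.univ.filter (fun io : Fin b × Fin b => p io.1 = true ∧ p io.2 = false ∧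
        ¬ ((p, io) ∉ S ∧ L ≤ rsc nb S (p, io)))) ⊆
          ((Finset.univ : Finset (Fin b)) ×ˢ (Finset.univ.filter (fun t => th t p < L))) ∪ E := by
        rintro ⟨i, o⟩ hio
        simp only [Finset.mem_filter, Finset.mem_univ, true_and] at hio
        rw [Finset.mem_union]
        by_cases ho : th o p < L
        · left; simp [ho]
        · right
          rw [hEdef, Finset.mem_filter]
          refine ⟨Finset.mem_univ _, hio.1, hio.2.1, ?_⟩
          rintro ⟨g1, g2, g3⟩
          apply hio.2.2
          refine ⟨g1, ?_⟩
          simp only at g3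
          omega
      refine (Finset.card_le_card hsub).trans ((Finset.card_union_le _ _).trans ?_)
      rw [Finset.card_product, Finset.card_univ, Fintype.card_fin]
      have : b * (Finset.univ.filter (fun t => th t p < L)).card ≤ b * (32 * n) := Nat.mul_le_mul_left _ hcnt.le
      have : b * (32 * n) = 32 * n * b := by ring
      omega
    · exfalso
      have hlt : m < L := lt_of_le_of_ne hmL hmL'
      have hI := hm2.resolve_left hmL'
      have hO := exc_prod E hE _ (Finset.univ.filter (fun o => p o = false ∧ m ≤ th o p)) hI (by
        intro i hi o ho
        simp only [Finset.mem_filter, Finset.mem_univ, true_and] at hi ho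
        rw [hEdef, Finset.mem_filter]
        refine ⟨Finset.mem_univ _, hi.1, ho.1, ?_⟩
        rintro ⟨g1, g2, g3⟩
        simp only at g2 g3
        omega)
      apply hp2
      refine Finset.mem_biUnion.2 ⟨m, Finset.mem_range.2 hlt, ?_⟩
      simp only [bad2, Finset.mem_filter, Finset.mem_univ, true_and]
      refine ⟨?_, ?_⟩
      · rw [Finset.filter_true_of_mem]
        · simp
        · intro t _
          simp only [pr2]; split_ifs <;> simp
      · have : (Finset.univ.filter (fun t => pr2 m t p = some (! p t))) ⊆
            (Finset.univ.filter (fun i => p i = true ∧ th i p < m)) ∪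
            (Finset.univ.filter (fun o => p o = false ∧ m ≤ th o p)) := by
          intro t ht
          simp only [Finset.mem_filter, Finset.mem_univ, true_and, pr2, Finset.mem_union] at ht ⊢
          split_ifs at ht with hlt
          · left
            simp only [Option.some.injEq] at ht
            refine ⟨?_, hlt⟩
            revert ht; cases p t <;> simp
          · right
            simp only [Option.some.injEq] at ht
            refine ⟨?_, not_lt.1 hlt⟩
            revert ht; cases p t <;> simp
        refine (Finset.card_le_card this).trans ((Finset.card_union_le _ _).trans ?_)
        omega


theorem hitting {V : Type} [Fintype V] [DecidableEq V] (R : V → Finset V) (K L : ℕ)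
    (hN : 0 < Fintype.card V) (hKL : 2 ^ 20 * Fintype.card V ≤ K * L) :
    ∃ f : Fin K → V, (Finset.univ.filter (fun v => L ≤ (R v).card ∧ ∀ k, f k ∉ R v)).card * 2 ^ 20 ≤
      Fintype.card V := by
  classical
  by_contra hcon
  push Not at hcon
  set N := Fintype.card V with hNdef
  have : Nonempty V := Fintype.card_pos_iff.1 hN
  have h1 : ∑ f : Fin K → V, N < ∑ f : Fin K → V,
      (Finset.univ.filter (fun v => L ≤ (R v).card ∧ ∀ k, f k ∉ R v)).card * 2 ^ 20 :=
    Finset.sum_lt_sum_of_nonempty Finset.univ_nonempty (fun f _ => hcon f)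
  rw [Finset.sum_const, ← Finset.sum_mul] at h1
  have h2 : ∑ f : Fin K → V, (Finset.univ.filter (fun v => L ≤ (R v).card ∧ ∀ k, f k ∉ R v)).card ≤
      N * (N - L) ^ K := by
    simp only [Finset.card_filter]
    rw [Finset.sum_comm]
    rw [hNdef, ← Finset.card_univ, ← smul_eq_mul]
    apply Finset.sum_le_card_nsmul
    intro v _
    rw [← Finset.card_filter]
    by_cases hv : L ≤ (R v).card
    · have : (Finset.univ.filter (fun f : Fin K → V => L ≤ (R v).card ∧ ∀ k, f k ∉ R v)) =
          Fintype.piFinset (fun _ : Fin K => (R v)ᶜ) := by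
        ext f; simp [hv]
      rw [this, Fintype.card_piFinset_const, Finset.card_compl]
      apply Nat.pow_le_pow_left
      rw [Finset.card_univ]
      omega
    · rw [Finset.filter_false_of_mem]
      · simp
      · intro f _ h; exact hv h.1
  have h3 : 2 ^ 20 * (N - L) ^ K ≤ N ^ K := by
    have hNr : (0 : ℝ) < N := by exact_mod_cast hN
    have e1 : ((N - L : ℕ) : ℝ) ≤ N * Real.exp (-(L / N)) := by
      by_cases hLN : L ≤ N
      · rw [Nat.cast_sub hLN]
        have h := Real.add_one_le_exp (-((L : ℝ) / N))
        have : (N : ℝ) * (-((L : ℝ) / N) + 1) = N - L := by field_simp; ring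
        rw [← this]
        gcongr
      · rw [Nat.sub_eq_zero_of_le (by omega)]
        simp; positivity
    have e2 : ((N - L : ℕ) : ℝ) ^ K ≤ N ^ K * Real.exp (-(2 ^ 20)) := by
      calc ((N - L : ℕ) : ℝ) ^ K ≤ (N * Real.exp (-(L / N))) ^ K := by gcongr
        _ = N ^ K * Real.exp (K * (-(L / N))) := by rw [mul_pow, ← Real.exp_nat_mul]
        _ ≤ _ := by
          gcongr
          have : (2 : ℝ) ^ 20 * N ≤ K * L := by exact_mod_cast hKL
          have h4 : (2 : ℝ) ^ 20 ≤ K * L / N := by rw [le_div_iff₀ hNr]; exact this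
          have h5 : (K : ℝ) * (-(L / N)) = -(K * L / N) := by ring
          rw [h5]; linarith
    have e3 : (2 : ℝ) ^ 20 ≤ Real.exp (2 ^ 20) := by
      linarith [Real.add_one_le_exp ((2 : ℝ) ^ 20)]
    have e4 : (2 : ℝ) ^ 20 * ((N - L : ℕ) : ℝ) ^ K ≤ N ^ K := by
      calc (2 : ℝ) ^ 20 * ((N - L : ℕ) : ℝ) ^ K ≤ Real.exp (2 ^ 20) * (N ^ K * Real.exp (-(2 ^ 20))) := by gcongr
        _ = N ^ K * (Real.exp (2 ^ 20) * Real.exp (-(2 ^ 20))) := by ring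
        _ = N ^ K := by rw [← Real.exp_add, add_neg_cancel, Real.exp_zero, mul_one]
    exact_mod_cast e4
  have h4 : (Finset.univ : Finset (Fin K → V)).card = N ^ K := by
    rw [Finset.card_univ]; simp [hNdef]
  rw [h4, smul_eq_mul] at h1
  have h5 := Nat.mul_le_mul_left N h3
  have h6 := Nat.mul_le_mul_right (2 ^ 20) h2
  have : N * (2 ^ 20 * (N - L) ^ K) = N * (N - L) ^ K * 2 ^ 20 := by ring
  have : N ^ K * N = N * N ^ K := by ring
  omega

theorem balance {n b : ℕ} (hn : 1 ≤ n) (hb : b = 16384 * n) (c : Bool) :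
    2 ^ 8 * (Finset.univ.filter (fun p : PB b => (Finset.univ.filter (fun t => p t = c)).card ≤ 4096 * n)).card
      ≤ 2 ^ b := by
  have hsum := coin_sum (1 / 2) (by norm_num) b (fun _ _ => some (! c)) (fun _ _ _ _ => rfl)
  set Q := (Finset.univ.filter (fun p : PB b => (Finset.univ.filter (fun t => p t = c)).card ≤ 4096 * n)) with hQ
  have hw : ∀ y, fac (1 / 2) (some (! c)) y = 4 / 3 * (if y = c then 1 / 2 else 1) := by
    intro y
    cases y <;> cases c <;> simp [fac] <;> norm_num
  simp only [hw] at hsum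
  have hprod : ∀ p ∈ Q, (4 / 3 : ℝ) ^ b * (1 / 2) ^ (4096 * n) ≤
      ∏ t : Fin b, (4 / 3 * (if p t = c then 1 / 2 else 1) : ℝ) := by
    intro p hp
    rw [Finset.prod_mul_distrib, Finset.prod_const, Finset.card_univ, Fintype.card_fin, Finset.prod_ite]
    simp only [Finset.prod_const, one_pow, mul_one]
    gcongr ?_ * ?_
    exact pow_le_pow_of_le_one (by norm_num) (by norm_num) (Finset.mem_filter.1 hp).2
  have h3 : (Q.card : ℝ) * ((4 / 3 : ℝ) ^ b * (1 / 2) ^ (4096 * n)) ≤ 2 ^ b := by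
    rw [← hsum, ← nsmul_eq_mul, ← Finset.sum_const]
    refine (Finset.sum_le_sum hprod).trans ?_
    refine Finset.sum_le_sum_of_subset_of_nonneg (Finset.subset_univ _)
      (fun p _ _ => Finset.prod_nonneg fun t _ => ?_)
    split_ifs <;> norm_num
  have h4 : (2 : ℝ) ^ 8 ≤ (4 / 3 : ℝ) ^ b * (1 / 2) ^ (4096 * n) := by
    have e : (4 / 3 : ℝ) ^ b * (1 / 2) ^ (4096 * n) = ((4 / 3) ^ 4 * (1 / 2)) ^ (4096 * n) := by
      rw [mul_pow, ← pow_mul, hb]; congr 2; ring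
    rw [e]
    calc (2 : ℝ) ^ 8 ≤ 1 + ((4096 * n : ℕ) : ℝ) * (1 / 2) := by
          have : (1 : ℝ) ≤ n := by exact_mod_cast hn
          push_cast
          linarith
      _ ≤ (1 + 1 / 2) ^ (4096 * n) := one_add_mul_le_pow (by norm_num) _
      _ ≤ _ := by
        apply pow_le_pow_left₀ (by norm_num)
        norm_num
  have h5 : (2 : ℝ) ^ 8 * Q.card ≤ 2 ^ b := by
    refine le_trans ?_ h3
    rw [mul_comm]
    gcongr
  exact_mod_cast h5

theorem hubL {n b d : ℕ} (hn : 10 ≤ n) (hb : b = 16384 * n) {nb : VB b → Fin d → VB b}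
    (hnb : NbOK b (2 ^ 38) d nb) (S : Finset (VB b)) (hS : 2 ^ 37 * S.card ≤ Fintype.card (VB b))
    (K : ℕ) (hKn : K + 1 ≤ 2 ^ (34 * n)) (h : VB b → ℕ) (hK : ∀ v, h v ≤ K)
    (hmono : ∀ u v, BA nb u v → u ∉ S → v ∉ S → h v ≤ h u) :
    ∃ mm : PB b → ℕ, (∀ p p', (∀ s : Fin b, s.1 < 134 * n → p s = p' s) → mm p = mm p') ∧
    ∃ bad : Finset (PB b), 2 ^ 7 * bad.card ≤ 2 ^ b ∧ ∀ p, p ∉ bad →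
        (Finset.univ.filter (fun io : Fin b × Fin b => p io.1 = true ∧ p io.2 = false ∧
        ¬ ((p, io) ∉ S ∧ h (p, io) = mm p))).card ≤ 2195457 * n ^ 2 := by
  classical
  obtain ⟨th, h1, h2, bad0, hbad0, hgood⟩ := THg (by omega) hb hnb S hS K h h hK hmono
  let pr : ℕ → Fin b → PB b → Option Bool := fun m t p =>
    if th t p < m then some false else if m < th t p then some true else none
  have hc := fun m => coin n b hb (67 * n) (pr m) (by intro t p p' h; simp only [pr]; rw [h2 t p p' h])
  let bad1 : ℕ → Finset (PB b) := fun m => (Finset.univ.filter (fun p : Fin b → Bool =>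
      67 * n ≤ (Finset.univ.filter (fun t => pr m t p ≠ none)).card ∧
      (Finset.univ.filter (fun t => pr m t p = some (! p t))).card ≤ 2 * n))
  have k1 : ∀ m, (bad1 m).card ≤ 2 ^ (b - 37 * n) := by
    intro m
    have : (bad1 m).card * 2 ^ (67 * n) ≤ 2 ^ (b - 37 * n) * 2 ^ (67 * n) := by
      rw [← pow_add, show b - 37 * n + 67 * n = b + 30 * n by omega]; exact hc m
    exact Nat.le_of_mul_le_mul_right this (by positivity)
  have k3 : ((Finset.range (K + 1)).biUnion bad1).card ≤ 2 ^ (b - 3 * n) := by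
    refine Finset.card_biUnion_le.trans ((Finset.sum_le_card_nsmul _ _ _ (fun m _ => k1 m)).trans ?_)
    rw [Finset.card_range, smul_eq_mul]
    refine (Nat.mul_le_mul_right _ hKn).trans ?_
    rw [← pow_add]
    exact Nat.pow_le_pow_right (by norm_num) (by omega)
  let maj : PB b → Set ℕ := fun p =>
    {m | 67 * n < (Finset.univ.filter (fun t : Fin b => t.1 < 134 * n ∧ th t p = m)).card}
  refine ⟨fun p => sInf (maj p), ?_, bad0 ∪ (Finset.range (K + 1)).biUnion bad1, ?_, ?_⟩
  · intro p p' hpp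
    have : maj p = maj p' := by
      ext m
      show 67 * n < (Finset.univ.filter (fun t : Fin b => t.1 < 134 * n ∧ th t p = m)).card ↔ 67 * n < (Finset.univ.filter (fun t : Fin b => t.1 < 134 * n ∧ th t p' = m)).card
      have : (Finset.univ.filter (fun t : Fin b => t.1 < 134 * n ∧ th t p = m)) =
          (Finset.univ.filter (fun t : Fin b => t.1 < 134 * n ∧ th t p' = m)) := by
        apply Finset.filter_congr
        intro t _
        refine and_congr_right fun ht => ?_
        rw [h2 t p p' (fun s hs => hpp s (lt_trans hs ht))]
      rw [this]
    simp only [this]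
  · have h5 := Finset.card_union_le bad0 ((Finset.range (K + 1)).biUnion bad1)
    have h6 : 2 ^ 8 * 2 ^ (b - 3 * n) ≤ 2 ^ b := by
      rw [← pow_add]; exact Nat.pow_le_pow_right (by norm_num) (by omega)
    omega
  · intro p hp
    simp only [Finset.mem_union, not_or] at hp
    obtain ⟨hp0, hp1⟩ := hp
    have hE := hgood p hp0
    set E := (Finset.univ.filter (fun io : Fin b × Fin b => p io.1 = true ∧ p io.2 = false ∧
        ¬ ((p, io) ∉ S ∧ h (p, io) ≤ th io.1 p ∧ th io.2 p ≤ h (p, io)))) with hEdef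
    obtain ⟨m, hmK, hm1, hm2⟩ := levelm p (fun t => th t p) n K
    have hO : (Finset.univ.filter (fun o => p o = false ∧ m < th o p)).card ≤ n := by
      rcases hm2 with rfl | hI
      · rw [Finset.filter_false_of_mem]
        · simp
        · rintro o _ ⟨_, ho⟩
          have := h1 o p
          omega
      · refine exc_prod E hE _ _ hI ?_
        intro i hi o ho
        simp only [Finset.mem_filter, Finset.mem_univ, true_and] at hi ho
        rw [hEdef, Finset.mem_filter]
        refine ⟨Finset.mem_univ _, hi.1, ho.1, ?_⟩
        rintro ⟨g1, g2, g3⟩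
        simp only at g2 g3
        omega
    have hcnt : (Finset.univ.filter (fun t => th t p ≠ m)).card < 67 * n := by
      by_contra hge
      push Not at hge
      apply hp1
      refine Finset.mem_biUnion.2 ⟨m, Finset.mem_range.2 (by omega), ?_⟩
      simp only [bad1, Finset.mem_filter, Finset.mem_univ, true_and]
      refine ⟨hge.trans (Finset.card_le_card ?_), ?_⟩
      · intro t ht
        simp only [Finset.mem_filter, Finset.mem_univ, true_and, pr] at ht ⊢
        split_ifs with a c
        · simp
        · simp
        · exact absurd (le_antisymm (not_lt.1 c) (not_lt.1 a)) ht
      · have : (Finset.univ.filter (fun t => pr m t p = some (! p t))) ⊆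
            (Finset.univ.filter (fun i => p i = true ∧ th i p < m)) ∪
            (Finset.univ.filter (fun o => p o = false ∧ m < th o p)) := by
          intro t ht
          simp only [Finset.mem_filter, Finset.mem_univ, true_and, pr, Finset.mem_union] at ht ⊢
          split_ifs at ht with hlt hlt'
          · left
            simp only [Option.some.injEq] at ht
            refine ⟨?_, hlt⟩
            revert ht; cases p t <;> simp
          · right
            simp only [Option.some.injEq] at ht
            refine ⟨?_, hlt'⟩
            revert ht; cases p t <;> simp
        refine (Finset.card_le_card this).trans ((Finset.card_union_le _ _).trans ?_)
        omega
    have hlow : (Finset.univ.filter (fun t : Fin b => t.1 < 134 * n)).card = 134 * n := by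
      rw [Fin.card_filter_val_lt]; omega
    have hmaj : m ∈ maj p := by
      show 67 * n < _
      have : (Finset.univ.filter (fun t : Fin b => t.1 < 134 * n)) ⊆
          (Finset.univ.filter (fun t : Fin b => t.1 < 134 * n ∧ th t p = m)) ∪
          (Finset.univ.filter (fun t => th t p ≠ m)) := by
        intro t ht
        simp only [Finset.mem_filter, Finset.mem_univ, true_and, Finset.mem_union] at ht ⊢
        tauto
      have := (Finset.card_le_card this).trans (Finset.card_union_le _ _)
      omega
    have huniq : ∀ m' ∈ maj p, m' = m := by
      intro m' hm'
      by_contra hne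
      have hm' : 67 * n < (Finset.univ.filter (fun t : Fin b => t.1 < 134 * n ∧ th t p = m')).card := hm'
      have : (Finset.univ.filter (fun t : Fin b => t.1 < 134 * n ∧ th t p = m')) ⊆
          (Finset.univ.filter (fun t => th t p ≠ m)) := by
        intro t ht
        simp only [Finset.mem_filter, Finset.mem_univ, true_and] at ht ⊢
        rw [ht.2]; exact hne
      have := Finset.card_le_card this
      omega
    have hsInf : sInf (maj p) = m := huniq _ (Nat.sInf_mem ⟨m, hmaj⟩)
    simp only [hsInf]
    set W := (Finset.univ.filter (fun t => th t p ≠ m)) with hW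
    have hsub : (Finset.univ.filter (fun io : Fin b × Fin b => p io.1 = true ∧ p io.2 = false ∧
        ¬ ((p, io) ∉ S ∧ h (p, io) = m))) ⊆
        E ∪ ((W ×ˢ Finset.univ) ∪ (Finset.univ ×ˢ W)) := by
      rintro ⟨i, o⟩ hio
      simp only [Finset.mem_filter, Finset.mem_univ, true_and] at hio
      by_cases hi : th i p = m
      · by_cases ho : th o p = m
        · rw [Finset.mem_union]; left
          rw [hEdef, Finset.mem_filter]
          refine ⟨Finset.mem_univ _, hio.1, hio.2.1, ?_⟩
          rintro ⟨g1, g2, g3⟩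
          simp only at g2 g3
          exact hio.2.2 ⟨g1, by omega⟩
        · simp [hW, ho]
      · simp [hW, hi]
    have h7 := (Finset.card_le_card hsub).trans ((Finset.card_union_le _ _).trans
      (Nat.add_le_add_left (Finset.card_union_le _ _) _))
    simp only [Finset.card_product, Finset.card_univ, Fintype.card_fin] at h7
    refine h7.trans ?_
    have h8 : W.card * b ≤ 67 * n * b := Nat.mul_le_mul_right _ hcnt.le
    have h9 : 67 * n * b = 1097728 * n ^ 2 := by rw [hb]; ring
    rw [mul_comm b]
    omega


theorem Kb1 (m : ℕ) : 2 ^ 24 * (100 + m) + 1 ≤ 2 ^ (100 + m) := by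
  have : m < 2 ^ m := Nat.lt_two_pow_self
  rw [pow_add]
  have h2 : (2 ^ 24 * 102) * 2 ^ m ≤ 2 ^ 100 * 2 ^ m := Nat.mul_le_mul_right _ (by norm_num)
  omega

theorem Kbound (n : ℕ) (hn : 100 ≤ n) : 2 ^ (32 * n + 48) * n ^ 2 + 1 ≤ 2 ^ (34 * n) := by
  have h1 : 2 ^ 24 * n + 1 ≤ 2 ^ n := by
    have := Kb1 (n - 100)
    rwa [Nat.add_sub_cancel' hn] at this
  clear hn
  have h3 : (2 ^ 24 * n + 1) * (2 ^ 24 * n + 1) ≤ 2 ^ n * 2 ^ n := Nat.mul_le_mul h1 h1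
  have h4 : (2 ^ 24 * n) ^ 2 + 1 ≤ 2 ^ (2 * n) := by
    rw [two_mul, pow_add]; nlinarith
  have hx : 2 ^ (32 * n + 48) = 2 ^ (32 * n) * 2 ^ 48 := pow_add _ _ _
  have e1 : 2 ^ (32 * n + 48) * n ^ 2 = 2 ^ (32 * n) * (2 ^ 24 * n) ^ 2 := by
    generalize 2 ^ (32 * n + 48) = x at hx ⊢
    subst hx
    generalize 2 ^ (32 * n) = y
    ring
  have e2 : 2 ^ (34 * n) = 2 ^ (32 * n) * 2 ^ (2 * n) := by
    rw [show 34 * n = 32 * n + 2 * n by ring]; exact pow_add _ _ _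
  rw [e1, e2]
  have h5 := Nat.mul_le_mul_left (2 ^ (32 * n)) h4
  have h6 : 1 ≤ 2 ^ (32 * n) := Nat.one_le_two_pow
  rw [mul_add] at h5
  linarith

theorem posL {n b d : ℕ} (hn : 100 ≤ n) (hb : b = 16384 * n) {nb : VB b → Fin d → VB b}
    (hnb : NbOK b (2 ^ 38) d nb) (S : Finset (VB b)) (hS : 2 ^ 37 * S.card ≤ Fintype.card (VB b)) :
    ∃ bad : Finset (PB b), 32 * bad.card ≤ 2 ^ b ∧ ∃ w : PB b → VB b,
      (∀ p p', (∀ s : Fin b, s.1 < 134 * n → p s = p' s) → w p = w p') ∧ ∀ p, p ∉ bad →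
        4096 * n ≤ (Finset.univ.filter (fun t => p t = true)).card ∧
        4096 * n ≤ (Finset.univ.filter (fun t => p t = false)).card ∧
        ∃ X : Finset (Fin b × Fin b), X.card ≤ 2195457 * n ^ 2 ∧ ∀ io, p io.1 = true → p io.2 = false →
          io ∉ X → (p, io) ∉ S ∧ AR nb S (p, io) (w p) := by
  classical
  set K := 2 ^ (32 * n + 48) * n ^ 2 with hK
  set L := 2 ^ (b - 32 * n) with hL
  have hcard := card_VB n b hb
  have hKL : K * L = 2 ^ 20 * Fintype.card (VB b) := by
    rw [hcard]
    have : 2 ^ (32 * n) * 2 ^ (b - 32 * n) = 2 ^ b := by rw [← pow_add]; congr 1; omega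
    rw [hK, hL, ← this, pow_add]
    ring
  have hcpos : 0 < Fintype.card (VB b) := by rw [hcard]; positivity
  obtain ⟨f, hf⟩ := hitting (fun v => Finset.univ.filter (fun w => AR nb S v w)) K L hcpos hKL.ge
  set F := (Finset.univ.filter (fun v => L ≤ (Finset.univ.filter (fun w => AR nb S v w)).card ∧
    ∀ k, f k ∉ (Finset.univ.filter (fun w => AR nb S v w)))) with hF
  let h : VB b → ℕ := fun v => (Finset.univ.filter (fun k => AR nb S v (f k))).sup (fun k => k.1 + 1)
  obtain ⟨mm, hmm, bad1, hbad1, hg1⟩ := hubL (by omega) hb hnb S hS K (Kbound n hn) h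
    (by intro v; exact Finset.sup_le (fun k _ => k.2))
    (by
      intro u v huv hu hv
      apply Finset.sup_mono
      intro k hk
      simp only [Finset.mem_filter, Finset.mem_univ, true_and] at hk ⊢
      exact ReflTransGen.head ⟨huv, hu, hv⟩ hk)
  obtain ⟨bad2, hbad2, hg2⟩ := depthL (by omega) hb hnb S hS
  have hbt := balance (by omega : 1 ≤ n) hb true
  have hbf := balance (by omega : 1 ≤ n) hb false
  set bt := (Finset.univ.filter (fun p : PB b => (Finset.univ.filter (fun t => p t = true)).card ≤ 4096 * n)) with hbtd
  set bf := (Finset.univ.filter (fun p : PB b => (Finset.univ.filter (fun t => p t = false)).card ≤ 4096 * n)) with hbfd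
  have hmk := markovB F (2 ^ 18 * n ^ 2)
  set bm := (Finset.univ.filter (fun p : PB b => 2 ^ 18 * n ^ 2 < (sl F p).card)) with hbm
  have hbmc : 2 ^ 10 * bm.card ≤ 2 ^ b := by
    have h1 : (2 ^ 10 * bm.card) * (2 ^ 28 * n ^ 2) ≤ 2 ^ b * (2 ^ 28 * n ^ 2) := by
      rw [← hcard]
      refine le_trans ?_ hf
      calc _ = (bm.card * (2 ^ 18 * n ^ 2)) * 2 ^ 20 := by ring
        _ ≤ _ := Nat.mul_le_mul_right _ hmk
    exact Nat.le_of_mul_le_mul_right h1 (by positivity)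
  have hne : Nonempty (VB b) := Fintype.card_pos_iff.1 hcpos
  let v0 : VB b := Classical.arbitrary _
  let wm : ℕ → VB b := fun m => if hm : m - 1 < K then f ⟨m - 1, hm⟩ else v0
  refine ⟨bad1 ∪ (bad2 ∪ (bt ∪ (bf ∪ bm))), ?_, fun p => wm (mm p), ?_, ?_⟩
  · have e1 := Finset.card_union_le bad1 (bad2 ∪ (bt ∪ (bf ∪ bm)))
    have e2 := Finset.card_union_le bad2 (bt ∪ (bf ∪ bm))
    have e3 := Finset.card_union_le bt (bf ∪ bm)
    have e4 := Finset.card_union_le bf bm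
    omega
  · intro p p' hpp
    simp only [hmm p p' hpp]
  · intro p hp
    simp only [Finset.mem_union, not_or] at hp
    obtain ⟨p1, p2, p3, p4, p5⟩ := hp
    have p3 : 4096 * n < (Finset.univ.filter (fun t => p t = true)).card := by
      by_contra hc; exact p3 (Finset.mem_filter.2 ⟨Finset.mem_univ _, not_lt.1 hc⟩)
    have p4 : 4096 * n < (Finset.univ.filter (fun t => p t = false)).card := by
      by_contra hc; exact p4 (Finset.mem_filter.2 ⟨Finset.mem_univ _, not_lt.1 hc⟩)
    have p5 : (sl F p).card ≤ 2 ^ 18 * n ^ 2 := by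
      by_contra hc; exact p5 (Finset.mem_filter.2 ⟨Finset.mem_univ _, not_le.1 hc⟩)
    refine ⟨p3.le, p4.le, _, hg1 p p1, ?_⟩
    have q1 := hg1 p p1
    have q2 := hg2 p p2
    set X1 := (Finset.univ.filter (fun io : Fin b × Fin b => p io.1 = true ∧ p io.2 = false ∧
        ¬ ((p, io) ∉ S ∧ h (p, io) = mm p))) with hX1
    set X2 := (Finset.univ.filter (fun io : Fin b × Fin b => p io.1 = true ∧ p io.2 = false ∧
        ¬ ((p, io) ∉ S ∧ 2 ^ (b - 32 * n) ≤ rsc nb S (p, io)))) with hX2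
    have hX1' : ∀ io : Fin b × Fin b, p io.1 = true → p io.2 = false → io ∉ X1 →
        (p, io) ∉ S ∧ h (p, io) = mm p := by
      intro io a1 a2 a3
      by_contra hc
      exact a3 (Finset.mem_filter.2 ⟨Finset.mem_univ _, a1, a2, hc⟩)
    have hX2' : ∀ io : Fin b × Fin b, p io.1 = true → p io.2 = false → io ∉ X2 →
        (p, io) ∉ S ∧ 2 ^ (b - 32 * n) ≤ rsc nb S (p, io) := by
      intro io a1 a2 a3
      by_contra hc
      exact a3 (Finset.mem_filter.2 ⟨Finset.mem_univ _, a1, a2, hc⟩)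
    have hpos : 1 ≤ mm p := by
      by_contra hc
      have hsub : (Finset.univ.filter (fun t => p t = true)) ×ˢ (Finset.univ.filter (fun t => p t = false))
          ⊆ X1 ∪ (X2 ∪ sl F p) := by
        intro io hio
        simp only [Finset.mem_product, Finset.mem_filter, Finset.mem_univ, true_and] at hio
        by_contra hni
        simp only [Finset.mem_union, not_or] at hni
        have a1 := hX1' io hio.1 hio.2 hni.1
        have a2 := hX2' io hio.1 hio.2 hni.2.1
        apply hni.2.2
        simp only [sl, Finset.mem_filter, Finset.mem_univ, true_and, hF]
        refine ⟨a2.2, fun k hk => ?_⟩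
        have : k.1 + 1 ≤ h (p, io) := Finset.le_sup (f := fun k : Fin K => k.1 + 1)
          (Finset.mem_filter.2 ⟨Finset.mem_univ _, hk⟩)
        omega
      have e := (Finset.card_le_card hsub).trans ((Finset.card_union_le _ _).trans
        (Nat.add_le_add_left (Finset.card_union_le _ _) _))
      rw [Finset.card_product] at e
      have e2 : (4096 * n) * (4096 * n) ≤ _ := Nat.mul_le_mul p3.le p4.le
      have e3 : 32 * n * b = 524288 * n ^ 2 := by rw [hb]; ring
      have e4 : (4096 * n) * (4096 * n) = 16777216 * n ^ 2 := by ring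
      have e5 : 0 < n ^ 2 := by positivity
      omega
    intro io a1 a2 a3
    obtain ⟨b1, b2⟩ := hX1' io a1 a2 a3
    refine ⟨b1, ?_⟩
    have hnee : (Finset.univ.filter (fun k => AR nb S (p, io) (f k))).Nonempty := by
      by_contra hc
      have : h (p, io) = 0 := by
        simp only [h]; rw [Finset.not_nonempty_iff_eq_empty.1 hc]; rfl
      omega
    obtain ⟨k, hk, hk2⟩ := Finset.exists_mem_eq_sup _ hnee (fun k : Fin K => k.1 + 1)
    have hk3 : mm p = k.1 + 1 := b2.symm.trans hk2
    have : wm (mm p) = f k := by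
      simp only [wm, hk3, Nat.add_sub_cancel, k.2, dif_pos]
    show AR nb S (p, io) (wm (mm p))
    rw [this]
    exact (Finset.mem_filter.1 hk).2


/-- swap of the first two blocks of coordinates -/
def tauB (b g : ℕ) (h : 2 * g ≤ b) (s : Fin b) : Fin b :=
  if h1 : s.1 < g then ⟨s.1 + g, by omega⟩ else if s.1 < 2 * g then ⟨s.1 - g, by omega⟩ else s

theorem tauB_tauB (b g : ℕ) (h : 2 * g ≤ b) (s : Fin b) : tauB b g h (tauB b g h s) = s := by
  have key : ∀ s, (tauB b g h s).1 = if s.1 < g then s.1 + g else if s.1 < 2 * g then s.1 - g else s.1 := by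
    intro s
    unfold tauB
    split_ifs <;> rfl
  ext
  rw [key, key]
  split_ifs <;> omega

/-- swap on points -/
def sw (b g : ℕ) (h : 2 * g ≤ b) (p : PB b) : PB b := fun s => p (tauB b g h s)

theorem sw_sw (b g : ℕ) (h : 2 * g ≤ b) (p : PB b) : sw b g h (sw b g h p) = p := by
  funext s; simp [sw, tauB_tauB]

/-- combine -/
def cmb {b : ℕ} (g : ℕ) (a p : PB b) : PB b := fun s => if s.1 < g then a s else p s

/-- validity of edges -/
def vldE {b d : ℕ} (e : VB b × Option (Fin d) × Fin 6) : Prop :=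
  match e with
  | (v, some _, _) => v.1 v.2.1 = true
  | (_, none, l) => l.1 < 5

/-- edge type -/
abbrev EC (b d : ℕ) : Type := {e : VB b × Option (Fin d) × Fin 6 // vldE e}

/-- source -/
def srcC {b d : ℕ} (nb : VB b → Fin d → VB b) (e : EC b d) : VB b × Fin 6 :=
  match e.1 with
  | (v, some j, l) => if l.1 % 2 = 0 then (nb v j, l) else (v, l)
  | (v, none, l) => (v, l)

/-- target -/
def tgtC {b d : ℕ} (nb : VB b → Fin d → VB b) (T : PB b → PB b) (e : EC b d) : VB b × Fin 6 :=
  match e.1 with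
  | (v, some j, l) => if l.1 % 2 = 0 then (v, l) else (nb v j, l)
  | (v, none, l) => if l.1 % 2 = 0 then (v, l + 1) else ((T v.1, v.2), l + 1)

/-- rank -/
noncomputable def rkC {b : ℕ} (x : VB b × Fin 6) : ℕ :=
  x.2.1 * (2 ^ b + 1) + (if x.2.1 % 2 = 0 then rkP x.1.1 else 2 ^ b - rkP x.1.1)

theorem rkP_le {b : ℕ} (p : PB b) : rkP p ≤ 2 ^ b := by
  classical
  refine (Finset.card_le_univ _).trans ?_
  rw [card_PB]

theorem rkC_lt {b q d : ℕ} {nb : VB b → Fin d → VB b} (hnb : NbOK b q d nb) (T : PB b → PB b) (e : EC b d) :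
    rkC (srcC nb e) < rkC (tgtC nb T e) := by
  obtain ⟨⟨v, o, l⟩, he⟩ := e
  cases o with
  | some j =>
    have h1 : rkP (nb v j).1 < rkP v.1 := BA_lt hnb ⟨he, j, rfl⟩
    have h2 := rkP_le v.1
    simp only [srcC, tgtC]
    split_ifs with h
    · simp only [rkC, h, if_true]; omega
    · simp only [rkC, h, if_false]; omega
  | none =>
    have he : l.1 < 5 := he
    have hl : (l + 1 : Fin 6).1 = l.1 + 1 := by
      rw [Fin.val_add]; simp; omega
    simp only [srcC, tgtC]
    have key : ∀ p p' : PB b, rkC ((p, v.2), l) < rkC ((p', v.2), l + 1) := by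
      intro p p'
      have h2 := rkP_le p
      simp only [rkC, hl]
      rw [add_mul]
      split_ifs <;> omega
    split_ifs with h
    · exact key v.1 v.1
    · exact key v.1 _

section paths
variable {b d : ℕ} {nb : VB b → Fin d → VB b} {T : PB b → PB b} {D : Finset (VB b × Fin 6)} {S : Finset (VB b)}

theorem path_even (hD : ∀ v, v ∉ S → ∀ l, (v, l) ∉ D) {u v : VB b} (hu : u ∉ S) (h : AR nb S u v) (l : Fin 6)
    (hl : l.1 % 2 = 0) : RR (srcC nb) (tgtC nb T) D (u, l) (v, l) := by
  refine ⟨hD _ hu _, ?_⟩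
  refine ReflTransGen.lift (fun v => (v, l)) ?_ _ _ h
  rintro x y ⟨⟨h1, j, rfl⟩, h2, h3⟩
  refine ⟨⟨⟨(y, some j, l), h1⟩, ?_, ?_⟩, hD _ h3 _⟩
  · simp [srcC, hl]
  · simp [tgtC, hl]

theorem AR_notin {u v : VB b} (hu : u ∉ S) (h : AR nb S u v) : v ∉ S := by
  induction h with
  | refl => exact hu
  | tail _ h _ => exact h.2.2

theorem path_odd (hD : ∀ v, v ∉ S → ∀ l, (v, l) ∉ D) {u v : VB b} (hu : u ∉ S) (h : AR nb S u v) (l : Fin 6)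
    (hl : ¬ l.1 % 2 = 0) : RR (srcC nb) (tgtC nb T) D (v, l) (u, l) := by
  refine ⟨hD _ (AR_notin hu h) _, ?_⟩
  have h := ReflTransGen.swap _ _ h
  refine ReflTransGen.lift (fun v => (v, l)) ?_ _ _ h
  rintro x y ⟨⟨h1, j, rfl⟩, h2, h3⟩
  refine ⟨⟨⟨(x, some j, l), h1⟩, ?_, ?_⟩, hD _ h2 _⟩
  · simp [srcC, hl]
  · simp [tgtC, hl]

theorem path_id (hD : ∀ v, v ∉ S → ∀ l, (v, l) ∉ D) {v : VB b} (hv : v ∉ S) (l : Fin 6)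
    (hl : l.1 % 2 = 0) (hl5 : l.1 < 5) : RR (srcC nb) (tgtC nb T) D (v, l) (v, l + 1) := by
  refine ⟨hD _ hv _, ReflTransGen.single ⟨⟨⟨(v, none, l), hl5⟩, ?_, ?_⟩, hD _ hv _⟩⟩
  · simp [srcC]
  · simp [tgtC, hl]

theorem path_T (hD : ∀ v, v ∉ S → ∀ l, (v, l) ∉ D) {v : VB b} (hv : v ∉ S) (hv' : (T v.1, v.2) ∉ S) (l : Fin 6)
    (hl : ¬ l.1 % 2 = 0) (hl5 : l.1 < 5) : RR (srcC nb) (tgtC nb T) D (v, l) ((T v.1, v.2), l + 1) := by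
  refine ⟨hD _ hv _, ReflTransGen.single ⟨⟨⟨(v, none, l), hl5⟩, ?_, ?_⟩, hD _ hv' _⟩⟩
  · simp [srcC]
  · simp [tgtC, hl]

/-- label -/
def Lb (nb : VB b → Fin d → VB b) (S : Finset (VB b)) (w : PB b → VB b) (p : PB b) (io : Fin b × Fin b) : Prop :=
  (p, io) ∉ S ∧ AR nb S (p, io) (w p)

theorem path_hub (hD : ∀ v, v ∉ S → ∀ l, (v, l) ∉ D) {w : PB b → VB b} {p p' : PB b} {io io' : Fin b × Fin b}
    (h : Lb nb S w p io) (h' : Lb nb S w p' io') (hw : w p = w p') (l : Fin 6) (hl : l.1 % 2 = 0)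
    (hl5 : l.1 < 5) : RR (srcC nb) (tgtC nb T) D ((p, io), l) ((p', io'), l + 1) := by
  refine RR_trans _ _ _ (path_even hD h.1 h.2 l hl) ?_
  refine RR_trans _ _ _ (path_id hD (AR_notin h.1 h.2) l hl hl5) ?_
  rw [hw]
  refine path_odd hD h'.1 h'.2 _ ?_
  have hl : (l + 1 : Fin 6).1 = l.1 + 1 := by
    rw [Fin.val_add]; simp; omega
  omega

theorem path_all (hD : ∀ v, v ∉ S → ∀ l, (v, l) ∉ D) (hT : ∀ p, T (T p) = p) {w : PB b → VB b}
    {a a' q q' : PB b} {io io' c c' : Fin b × Fin b}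
    (h1 : Lb nb S w a io) (h2 : Lb nb S w q c) (h3 : Lb nb S w (T q) c)
    (h4 : Lb nb S w (T q') c') (h5 : Lb nb S w q' c') (h6 : Lb nb S w a' io')
    (w1 : w a = w q) (w2 : w (T q) = w (T q')) (w3 : w q' = w a') :
    RR (srcC nb) (tgtC nb T) D ((a, io), 0) ((a', io'), 5) := by
  have e1 := path_hub (T := T) hD h1 h2 w1 0 (by decide) (by decide)
  have e2 := path_T (nb := nb) hD (v := (q, c)) h2.1 h3.1 (0 + 1) (by decide) (by decide)
  have e3 := path_hub (T := T) hD h3 h4 w2 (0 + 1 + 1) (by decide) (by decide)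
  have e4 := path_T (nb := nb) (T := T) hD (v := (T q', c')) h4.1 (by simpa [hT] using h5.1) (0 + 1 + 1 + 1)
    (by decide) (by decide)
  have e5 := path_hub (T := T) hD h5 h6 w3 (0 + 1 + 1 + 1 + 1) (by decide) (by decide)
  simp only [hT] at e4
  exact RR_trans _ _ _ e1 (RR_trans _ _ _ e2 (RR_trans _ _ _ e3 (RR_trans _ _ _ e4 e5)))
end paths


theorem tauB_ge (b g : ℕ) (h : 2 * g ≤ b) (s : Fin b) (hs : 2 * g ≤ s.1) : tauB b g h s = s := by
  unfold tauB
  rw [dif_neg (by omega), if_neg (by omega)]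

theorem high_count {b m : ℕ} (g : ℕ) (hg : 2 * g ≤ b) (p : PB b) (c : Bool)
    (h : m + 2 * g ≤ (Finset.univ.filter (fun t => p t = c)).card) :
    m ≤ (Finset.univ.filter (fun t : Fin b => p t = c ∧ 2 * g ≤ t.1)).card := by
  have h1 : (Finset.univ.filter (fun t => p t = c)) ⊆
      (Finset.univ.filter (fun t : Fin b => p t = c ∧ 2 * g ≤ t.1)) ∪
      (Finset.univ.filter (fun t : Fin b => t.1 < 2 * g)) := by
    intro t ht
    simp only [Finset.mem_union, Finset.mem_filter, Finset.mem_univ, true_and] at ht ⊢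
    by_cases h2 : t.1 < 2 * g
    · exact Or.inr h2
    · exact Or.inl ⟨ht, not_lt.1 h2⟩
  have h2 := (Finset.card_le_card h1).trans (Finset.card_union_le _ _)
  rw [Fin.card_filter_val_lt] at h2
  omega

theorem rich_count {b : ℕ} (g : ℕ) (B : Finset (PB b)) :
    (Finset.univ.filter (fun a : PB b => 2 ^ b ≤ 2 * (Finset.univ.filter (fun p => cmb g a p ∈ B)).card)).card
      ≤ 2 * B.card := by
  classical
  set Q := (Finset.univ.filter (fun a : PB b => 2 ^ b ≤ 2 * (Finset.univ.filter (fun p => cmb g a p ∈ B)).card))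
    with hQ
  have h1 : ∑ a : PB b, (Finset.univ.filter (fun p => cmb g a p ∈ B)).card = B.card * 2 ^ b := by
    have h2 : (Finset.univ.filter (fun x : PB b × PB b => cmb g x.1 x.2 ∈ B)).card = B.card * 2 ^ b := by
      rw [← card_PB b, ← Finset.card_univ, ← Finset.card_product]
      refine Finset.card_nbij' (fun x => (cmb g x.1 x.2, cmb g x.2 x.1))
        (fun x => (cmb g x.1 x.2, cmb g x.2 x.1)) ?_ ?_ ?_ ?_
      · intro x hx
        simpa using hx
      · intro x hx
        have e : cmb g (cmb g x.1 x.2) (cmb g x.2 x.1) = x.1 := by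
          funext s; simp only [cmb]; split_ifs <;> rfl
        simp only [Finset.coe_product, Set.mem_prod] at hx
        simpa [e] using hx.1
      · intro x _
        ext s <;> simp only [cmb] <;> split_ifs <;> rfl
      · intro x _
        ext s <;> simp only [cmb] <;> split_ifs <;> rfl
    rw [← h2, Finset.card_filter, ← Finset.univ_product_univ, Finset.sum_product]
    simp only [Finset.card_filter]
  have h3 : Q.card * 2 ^ b ≤ ∑ a ∈ Q, 2 * (Finset.univ.filter (fun p => cmb g a p ∈ B)).card := by
    rw [← smul_eq_mul]
    exact Finset.card_nsmul_le_sum _ _ _ (fun a ha => (Finset.mem_filter.1 ha).2)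
  have h4 : ∑ a ∈ Q, 2 * (Finset.univ.filter (fun p => cmb g a p ∈ B)).card ≤ 2 * (B.card * 2 ^ b) := by
    rw [← h1, ← Finset.mul_sum]
    exact Nat.mul_le_mul_left _ (Finset.sum_le_sum_of_subset (Finset.subset_univ _))
  rw [← mul_assoc] at h4
  exact Nat.le_of_mul_le_mul_right (h3.trans h4) (by positivity)

theorem card_slices {b : ℕ} (A : Finset (VB b)) (P : Finset (PB b)) (k : ℕ)
    (h : ∀ p ∈ P, k ≤ (sl A p).card) : P.card * k ≤ A.card := by
  classical
  have h1 : (P.sigma (fun p => sl A p)).card ≤ A.card := by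
    refine Finset.card_le_card_of_injOn (fun x => (x.1, x.2)) ?_ ?_
    · rintro ⟨p, io⟩ hx
      simp only [Finset.coe_sigma, Set.mem_sigma_iff, Finset.mem_coe, sl, Finset.mem_filter] at hx
      exact hx.2.2
    · rintro ⟨p, io⟩ _ ⟨p', io'⟩ _ h
      simp only [Prod.mk.injEq] at h
      obtain ⟨rfl, rfl⟩ := h
      rfl
  rw [Finset.card_sigma] at h1
  refine le_trans ?_ h1
  rw [← smul_eq_mul]
  exact Finset.card_nsmul_le_sum _ _ _ h

theorem coreN {n b d : ℕ} (hn : 100 ≤ n) (hb : b = 16384 * n) {nb : VB b → Fin d → VB b}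
    (hnb : NbOK b (2 ^ 38) d nb) (hg : 2 * (134 * n) ≤ b) (D : Finset (VB b × Fin 6))
    (hDc : 2 ^ 37 * D.card ≤ Fintype.card (VB b)) :
    ∃ A : Finset (VB b), Fintype.card (VB b) ≤ 40 * A.card ∧ ∀ x ∈ A, ∀ y ∈ A,
      RR (srcC nb) (tgtC nb (sw b (134 * n) hg)) D (x, 0) (y, 5) := by
  classical
  set S := D.image Prod.fst with hSdef
  have hD : ∀ v, v ∉ S → ∀ l, (v, l) ∉ D := by
    intro v hv l hl
    exact hv (Finset.mem_image.2 ⟨_, hl, rfl⟩)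
  have hS : 2 ^ 37 * S.card ≤ Fintype.card (VB b) :=
    (Nat.mul_le_mul_left _ Finset.card_image_le).trans hDc
  obtain ⟨bad, hbad, w, hw, hgood⟩ := posL hn hb hnb S hS
  set g := 134 * n with hgdef
  set T := sw b g hg with hT
  have hTT : ∀ p, T (T p) = p := sw_sw b g hg
  set B := bad ∪ bad.image T with hB
  have hBc : 16 * B.card ≤ 2 ^ b := by
    have h1 : B.card ≤ bad.card + (bad.image T).card := Finset.card_union_le _ _
    have h2 : (bad.image T).card ≤ bad.card := Finset.card_image_le
    omega
  have hB1 : ∀ q, q ∉ B → q ∉ bad := fun q hq h => hq (Finset.mem_union_left _ h)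
  have hB2 : ∀ q, q ∉ B → T q ∉ bad := fun q hq h =>
    hq (Finset.mem_union_right _ (Finset.mem_image.2 ⟨_, h, hTT q⟩))
  have hQ := rich_count g B
  set Q := (Finset.univ.filter (fun a : PB b => 2 ^ b ≤ 2 * (Finset.univ.filter (fun p => cmb g a p ∈ B)).card))
    with hQdef
  have hrich : ∀ a a', a ∉ Q → a' ∉ Q → ∃ p, cmb g a p ∉ B ∧ cmb g a' p ∉ B := by
    intro a a' ha ha'
    simp only [hQdef, Finset.mem_filter, Finset.mem_univ, true_and, not_le] at ha ha'
    by_contra hc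
    push Not at hc
    have : (Finset.univ : Finset (PB b)) ⊆ (Finset.univ.filter (fun p => cmb g a p ∈ B)) ∪
        (Finset.univ.filter (fun p => cmb g a' p ∈ B)) := by
      intro p _
      simp only [Finset.mem_union, Finset.mem_filter, Finset.mem_univ, true_and]
      by_cases h : cmb g a p ∈ B
      · exact Or.inl h
      · exact Or.inr (hc p h)
    have := (Finset.card_le_card this).trans (Finset.card_union_le _ _)
    rw [Finset.card_univ, card_PB] at this
    omega
  have hcommon : ∀ q, q ∉ B → ∃ c, Lb nb S w q c ∧ Lb nb S w (T q) c := by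
    intro q hq
    obtain ⟨o1, o2, X1, hX1, k1⟩ := hgood q (hB1 q hq)
    obtain ⟨_, _, X2, hX2, k2⟩ := hgood (T q) (hB2 q hq)
    have i1 := high_count (m := 3828 * n) g hg q true (by omega)
    have i2 := high_count (m := 3828 * n) g hg q false (by omega)
    set I := (Finset.univ.filter (fun t : Fin b => q t = true ∧ 2 * g ≤ t.1))
    set O := (Finset.univ.filter (fun t : Fin b => q t = false ∧ 2 * g ≤ t.1))
    have hlt : (X1 ∪ X2).card < (I ×ˢ O).card := by
      rw [Finset.card_product]
      have e1 := Nat.mul_le_mul i1 i2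
      have e2 := Finset.card_union_le X1 X2
      have e3 : 3828 * n * (3828 * n) = 14653584 * n ^ 2 := by ring
      have e5 : 0 < n ^ 2 := by positivity
      omega
    obtain ⟨c, hc1, hc2⟩ := Finset.exists_mem_notMem_of_card_lt_card hlt
    simp only [I, O, Finset.mem_product, Finset.mem_filter, Finset.mem_univ, true_and] at hc1
    simp only [Finset.mem_union, not_or] at hc2
    refine ⟨c, k1 c hc1.1.1 hc1.2.1 hc2.1, k2 c ?_ ?_ hc2.2⟩
    · simp only [hT, sw]; rw [tauB_ge _ _ _ _ hc1.1.2]; exact hc1.1.1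
    · simp only [hT, sw]; rw [tauB_ge _ _ _ _ hc1.2.2]; exact hc1.2.1
  refine ⟨Finset.univ.filter (fun v => v.1 ∉ Q ∧ Lb nb S w v.1 v.2), ?_, ?_⟩
  · set A := Finset.univ.filter (fun v : VB b => v.1 ∉ Q ∧ Lb nb S w v.1 v.2) with hA
    have h1 := card_slices A (Finset.univ \ (Q ∪ bad)) (14581759 * n ^ 2) (by
      intro p hp
      simp only [Finset.mem_sdiff, Finset.mem_union, not_or, Finset.mem_univ, true_and] at hp
      obtain ⟨o1, o2, X, hX, k⟩ := hgood p hp.2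
      have hsub : (Finset.univ.filter (fun t => p t = true)) ×ˢ (Finset.univ.filter (fun t => p t = false)) ⊆
          sl A p ∪ X := by
        intro io hio
        simp only [Finset.mem_product, Finset.mem_filter, Finset.mem_univ, true_and] at hio
        by_cases hx : io ∈ X
        · exact Finset.mem_union_right _ hx
        · apply Finset.mem_union_left
          simp only [sl, hA, Finset.mem_filter, Finset.mem_univ, true_and]
          exact ⟨hp.1, k io hio.1 hio.2 hx⟩
      have e := (Finset.card_le_card hsub).trans (Finset.card_union_le _ _)
      rw [Finset.card_product] at e
      have e2 : (4096 * n) * (4096 * n) ≤ _ := Nat.mul_le_mul o1 o2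
      have e4 : (4096 * n) * (4096 * n) = 16777216 * n ^ 2 := by ring
      omega)
    have h2 : 2 ^ b ≤ 2 * (Finset.univ \ (Q ∪ bad)).card := by
      have e1 := Finset.le_card_sdiff (Q ∪ bad) Finset.univ
      have e2 := Finset.card_union_le Q bad
      rw [Finset.card_univ, card_PB] at e1
      omega
    rw [card_VB n b hb]
    have h3 := Nat.mul_le_mul_right (14581759 * n ^ 2) h2
    have e5 : 2 ^ b * (2 ^ 28 * n ^ 2) ≤ 20 * (2 ^ b * (14581759 * n ^ 2)) := by
      have : 2 ^ 28 * n ^ 2 ≤ 20 * (14581759 * n ^ 2) := by omega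
      have := Nat.mul_le_mul_left (2 ^ b) this
      linarith
    linarith
  · rintro ⟨a, io⟩ hx ⟨a', io'⟩ hy
    simp only [Finset.mem_filter, Finset.mem_univ, true_and] at hx hy
    obtain ⟨p, hp1, hp2⟩ := hrich a a' hx.1 hy.1
    obtain ⟨c, c1, c2⟩ := hcommon _ hp1
    obtain ⟨c', c1', c2'⟩ := hcommon _ hp2
    refine path_all hD hTT hx.2 c1 c2 c2' c1' hy.2 (hw _ _ ?_) (hw _ _ ?_) (hw _ _ ?_)
    · intro s hs; simp only [cmb, hs, if_true]
    · intro s hs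
      have h1 : tauB b g hg s = ⟨s.1 + g, by omega⟩ := by
        unfold tauB; rw [dif_pos hs]
      simp only [hT, sw, h1, cmb]
      rw [if_neg (by omega), if_neg (by omega)]
    · intro s hs; simp only [cmb, hs, if_true]

/-- size function -/
def Nf (k : ℕ) : ℕ := 2 ^ (16384 * k) * (2 ^ 28 * k ^ 2)

theorem Nf_step : ∃ C, ∀ k, 1 ≤ k → Nf (k + 1) ≤ C * Nf k := by
  refine ⟨2 ^ 16384 * 4, fun k hk => ?_⟩
  unfold Nf
  have h1 : 2 ^ (16384 * (k + 1)) = 2 ^ (16384 * k) * 2 ^ 16384 := by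
    rw [mul_add, mul_one]; exact pow_add _ _ _
  rw [h1]
  generalize 2 ^ 16384 = x
  generalize 2 ^ (16384 * k) = y
  have h2 : (k + 1) ^ 2 ≤ 4 * k ^ 2 := by nlinarith
  calc y * x * (2 ^ 28 * (k + 1) ^ 2) ≤ y * x * (2 ^ 28 * (4 * k ^ 2)) := by gcongr
    _ = _ := by ring

theorem Nf_ge (k : ℕ) : k ≤ Nf k := by
  unfold Nf
  have h1 : 1 ≤ 2 ^ (16384 * k) := Nat.one_le_two_pow
  generalize 2 ^ (16384 * k) = y at h1
  have h2 : k ≤ 2 ^ 28 * k ^ 2 := by nlinarith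
  calc k ≤ 1 * (2 ^ 28 * k ^ 2) := by omega
    _ ≤ _ := Nat.mul_le_mul_right _ h1

theorem Nf_choose : ∃ C, ∀ m, 1 ≤ m → ∃ k, 100 ≤ k ∧ 2 ^ 37 * m ≤ Nf k ∧ Nf k ≤ C * m := by
  classical
  obtain ⟨C, hC⟩ := Nf_step
  refine ⟨Nf 100 + C * 2 ^ 37, fun m hm => ?_⟩
  have hex : ∃ k, 100 ≤ k ∧ 2 ^ 37 * m ≤ Nf k := by
    refine ⟨2 ^ 37 * m, by omega, Nf_ge _⟩
  have hs := Nat.find_spec hex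
  refine ⟨Nat.find hex, hs.1, hs.2, ?_⟩
  generalize hN : Nf 100 = N0
  rcases hs.1.eq_or_lt with h | h
  · rw [← h, hN]
    nlinarith [Nat.zero_le (C * 2 ^ 37 * m)]
  · have h2 := Nat.find_min hex (m := Nat.find hex - 1) (by omega)
    have h3 : Nf (Nat.find hex - 1) < 2 ^ 37 * m := by
      by_contra hc
      exact h2 ⟨by omega, not_lt.1 hc⟩
    have h4 := hC (Nat.find hex - 1) (by omega)
    rw [Nat.sub_add_cancel (by omega)] at h4
    refine h4.trans ?_
    have h5 := Nat.mul_le_mul_left C h3.le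
    nlinarith [Nat.zero_le (N0 * m)]

theorem core : CoreP := by
  classical
  obtain ⟨C, hC⟩ := Nf_choose
  obtain ⟨d, hd⟩ := exists_nb (2 ^ 38) (by norm_num)
  refine ⟨C * (6 * (d + 1)), 40, fun m hm => ?_⟩
  obtain ⟨k, hk, h1, h2⟩ := hC m hm
  obtain ⟨b, hb⟩ : ∃ b, b = 16384 * k := ⟨_, rfl⟩
  obtain ⟨nb, hnb⟩ := hd b
  have hg : 2 * (134 * k) ≤ b := by omega
  have hcard : Fintype.card (VB b) = Nf k := by rw [card_VB k b hb, hb]; rfl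
  refine ⟨VB b × Fin 6, EC b d, VB b, inferInstance, inferInstance, inferInstance, srcC nb,
    tgtC nb (sw b (134 * k) hg), rkC, fun v => (v, 0), fun v => (v, 5), ?_, ?_, ?_, ?_, rkC_lt hnb _, ?_⟩
  · rw [hcard]; omega
  · rw [hcard]; nlinarith [Nat.zero_le (C * m * d), Nat.zero_le (C * m)]
  · rw [Fintype.card_prod, hcard, Fintype.card_fin]
    nlinarith [Nat.zero_le (C * m * d), Nat.zero_le (C * m)]
  · rw [← Nat.card_eq_fintype_card]
    have h3 : Nat.card (EC b d) ≤ Nat.card (VB b × Option (Fin d) × Fin 6) :=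
      Nat.card_le_card_of_injective Subtype.val Subtype.val_injective
    refine h3.trans ?_
    rw [Nat.card_eq_fintype_card, Fintype.card_prod (VB b) _, Fintype.card_prod (Option (Fin d)) _, Fintype.card_option,
      Fintype.card_fin, Fintype.card_fin, hcard]
    calc Nf k * ((d + 1) * 6) ≤ C * m * ((d + 1) * 6) := Nat.mul_le_mul_right _ h2
      _ = _ := by ring
  · intro D hD
    obtain ⟨A, hA1, hA2⟩ := coreN hk hb hnb hg D (by
      rw [hcard]; exact (Nat.mul_le_mul_left _ hD).trans h1)
    exact ⟨A, A, hA1, hA1, hA2⟩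

end STR

/-- There exist constants `c1, c2 > 0` and a family of DAGs
`{M_n}` such that each `M_n` has `n` designated inputs, `n` designated outputs,
at most `c1·n` nodes, maximum indegree at most `c2`, and is maximally ST-robust. -/
theorem exists_linear_size_max_STRobust_family :
    ∃ c1 c2 : ℕ, 0 < c1 ∧ 0 < c2 ∧
      ∃ M : (n : ℕ) → IOGraph n, ∀ n, 1 ≤ n →
        Acyclic (M n).Adj ∧
        Nat.card (M n).V ≤ c1 * n ∧
        (∀ v : (M n).V, indeg (M n).Adj v ≤ c2) ∧
        MaxSTRobust (M n) := by
  exact final_of_GdP (GdP_of_core core)
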